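/- Let λ⁽¹⁾/μ⁽¹⁾, …, λ⁽ⁿ⁾/μ⁽ⁿ⁾ be n skew shapes, and let λ = λ⁽¹⁾ + ⋯ + λ⁽ⁿ⁾ and μ = μ⁽¹⁾ + ⋯ + μ⁽ⁿ⁾ (coordinatewise sums). Then ∏_{i=1}^{n} s_{λ^{{i,n}}/μ^{{i,n}}} − ∏_{i=1}^{n} s_{λ⁽ⁱ⁾/μ⁽ⁱ⁾} is Schur nonnegative. -/

import Mathlib

/-- The complete homogeneous symmetric function `h_m` in `N` variables,
with `h_m = 0` for `m < 0`. -/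
noncomputable def homog (N : ℕ) (m : ℤ) : MvPolynomial (Fin N) ℤ :=
  if 0 ≤ m then MvPolynomial.hsymm (Fin N) ℤ m.toNat else 0

/-- The skew Schur polynomial `s_{λ/μ}` in `N` variables, given by the
Jacobi–Trudi determinant `det (h_{λ_i - μ_j - i + j})_{i,j=1}^k`, where the
partitions `lam`, `mu` are recorded 0-indexed (`lam 0 = λ_1`). -/
noncomputable def skewSchur (N k : ℕ) (lam mu : ℕ → ℕ) : MvPolynomial (Fin N) ℤ :=
  Matrix.det (Matrix.of fun i j : Fin k =>
    homog N ((lam i : ℤ) - (mu j : ℤ) - (i : ℤ) + (j : ℤ)))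

/-- A symmetric polynomial is Schur nonnegative if it is a linear combination
with nonnegative coefficients of Schur polynomials `s_λ`. -/
def IsSchurNonneg (N : ℕ) (f : MvPolynomial (Fin N) ℤ) : Prop :=
  ∃ (m : ℕ) (c : Fin m → ℕ) (k : Fin m → ℕ) (lam : Fin m → ℕ → ℕ),
    (∀ i, Antitone (lam i)) ∧ (∀ i j, k i ≤ j → lam i j = 0) ∧
    f = ∑ i, (c i : ℤ) • skewSchur N (k i) (lam i) (fun _ => 0)

/-- The conjugate partition: `λ'_j = #{i : λ_i ≥ j}` (0-indexed:
`conjPart λ j = #{i : λ_i ≥ j + 1}`). -/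
noncomputable def conjPart (lam : ℕ → ℕ) : ℕ → ℕ :=
  fun j => Set.ncard {i : ℕ | j + 1 ≤ lam i}

/-- The partition `λ^{{i,n}} := ((λ')^{[i,n]})'`, where
`λ^{[i,n]} = (λ_i, λ_{i+n}, λ_{i+2n}, …)` (0-indexed `i : Fin n`). -/
noncomputable def braceQuot (n : ℕ) (i : Fin n) (lam : ℕ → ℕ) : ℕ → ℕ :=
  conjPart (fun j => conjPart lam (i + j * n))

section

open Finset


section hseries
variable {R : Type*} [CommRing R]

noncomputable def geoS (a : R) : PowerSeries R := PowerSeries.mk (fun r => a ^ r)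

theorem geoS_mul (a : R) : geoS a * (1 - PowerSeries.C a * PowerSeries.X) = 1 := by
  ext n
  rw [mul_sub, mul_one, map_sub]
  cases n with
  | zero => simp [geoS, ← mul_assoc]
  | succ n =>
    rw [← mul_assoc, PowerSeries.coeff_succ_mul_X, mul_comm, PowerSeries.coeff_C_mul]
    simp [geoS, PowerSeries.coeff_one, pow_succ, mul_comm]

/-- coefficients of a power series, extended by zero to the integers -/
noncomputable def zc (f : PowerSeries R) (m : ℤ) : R := if 0 ≤ m then PowerSeries.coeff m.toNat f else 0

theorem zc_neg (f : PowerSeries R) (m : ℤ) (h : m < 0) : zc f m = 0 := by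
  simp [zc, not_le.mpr h]

theorem zc_one (m : ℤ) : zc (1 : PowerSeries R) m = if m = 0 then 1 else 0 := by
  unfold zc
  split_ifs with h1 h2 h2
  · simp [h2]
  · rw [PowerSeries.coeff_one, if_neg (by omega)]
  · omega
  · rfl

theorem zc_mulX (f : PowerSeries R) (a : R) (m : ℤ) :
    zc (f * (1 - PowerSeries.C a * PowerSeries.X)) m = zc f m - a * zc f (m - 1) := by
  rcases lt_trichotomy m 0 with h | h | h
  · rw [zc_neg _ _ h, zc_neg _ _ h, zc_neg _ _ (by omega)]; simp
  · subst h
    simp [zc, ← mul_assoc, mul_sub]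
  · obtain ⟨n, rfl⟩ : ∃ n : ℕ, m = n + 1 := ⟨(m - 1).toNat, by omega⟩
    have h1 : (0 : ℤ) ≤ n + 1 := by omega
    have h2 : ((n : ℤ) + 1).toNat = n + 1 := by omega
    simp only [zc, if_pos h1, h2, add_sub_cancel_right, Int.natCast_nonneg, if_true, Int.toNat_natCast]
    rw [mul_sub, mul_one, map_sub, mul_comm (PowerSeries.C a), ← mul_assoc, mul_comm,
      ]
    rw [PowerSeries.coeff_C_mul, PowerSeries.coeff_succ_mul_X]

theorem zc_geo (f : PowerSeries R) (a : R) (m : ℤ) :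
    zc (f * geoS a) m = zc f m + a * zc (f * geoS a) (m - 1) := by
  have := zc_mulX (f * geoS a) a m
  rw [mul_assoc, geoS_mul, mul_one] at this
  rw [this]; ring

theorem zc_geo_iter (f : PowerSeries R) (a : R) (m : ℤ) (d : ℕ) :
    zc (f * geoS a) m = ∑ r ∈ range d, a ^ r * zc f (m - r) + a ^ d * zc (f * geoS a) (m - d) := by
  induction d with
  | zero => simp
  | succ d ih =>
    rw [ih, sum_range_succ, zc_geo f a (m - d)]
    have : m - (d : ℤ) - 1 = m - ((d + 1 : ℕ) : ℤ) := by push_cast; ring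
    rw [this]; ring

end hseries

noncomputable def varN (N l : ℕ) : MvPolynomial (Fin N) ℤ := if h : l < N then MvPolynomial.X ⟨l, h⟩ else 0

noncomputable def Hs (N n : ℕ) : PowerSeries (MvPolynomial (Fin N) ℤ) := ∏ l ∈ range n, geoS (varN N l)

theorem Hs_fin (N : ℕ) : Hs N N = ∏ l : Fin N, geoS (MvPolynomial.X l) := by
  unfold Hs
  rw [← Fin.prod_univ_eq_prod_range (fun l => geoS (varN N l)) N]
  simp [varN]

theorem homog_eq (N : ℕ) (m : ℤ) : homog N m = zc (Hs N N) m := by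
  unfold homog zc
  split_ifs with h
  · generalize m.toNat = d
    rw [Hs_fin, PowerSeries.coeff_prod]
    unfold MvPolynomial.hsymm
    symm
    refine Finset.sum_bij' (fun l hl => (Sym.equivNatSum (Fin N) d).symm ⟨l, ?_⟩)
      (fun s _ => (Sym.equivNatSum (Fin N) d s).1) ?_ ?_ ?_ ?_ ?_
    · exact (Finset.mem_finsuppAntidiag'.1 hl).1
    · intro l hl; simp
    · intro s hs
      have := (Sym.equivNatSum (Fin N) d s).2
      rw [Finset.mem_finsuppAntidiag']
      exact ⟨this, by simp⟩
    · intro l hl; simp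
    · intro s hs; simp
    · intro l hl
      simp only [geoS, PowerSeries.coeff_mk]
      change _ = (Multiset.map MvPolynomial.X (Finsupp.toMultiset l)).prod
      rw [Finsupp.toMultiset_map, Finsupp.prod_toMultiset,
        Finsupp.prod_mapDomain_index (by simp) (by intros; rw [pow_add]), Finsupp.prod_fintype _ _ (by simp)]
  · rfl


section JT
variable {R : Type*} [CommRing R]

noncomputable def JT (f : PowerSeries R) (k : ℕ) (lam mu : ℕ → ℕ) : R :=
  Matrix.det (Matrix.of fun i j : Fin k => zc f ((lam i : ℤ) - (mu j : ℤ) - (i : ℤ) + (j : ℤ)))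

def ext0 {k : ℕ} (v : Fin k → ℕ) : ℕ → ℕ := fun n => if h : n < k then v ⟨n, h⟩ else 0

theorem ext0_fin {k : ℕ} (v : Fin k → ℕ) (i : Fin k) : ext0 v i = v i := by
  simp [ext0]

theorem JT_rowsum (f : PowerSeries R) (a : R) (L M : ℕ) (h : M ≤ L) (c : ℤ) :
    zc (f * geoS a) ((L : ℤ) - c) = ∑ v ∈ Icc M L, a ^ (L - v) * zc f ((v : ℤ) - c)
      + a ^ (L - M + 1) * zc (f * geoS a) ((M : ℤ) - 1 - c) := by
  rw [zc_geo_iter f a _ (L - M + 1)]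
  congr 1
  · refine Finset.sum_bij' (fun r _ => L - r) (fun v _ => L - v) ?_ ?_ ?_ ?_ ?_
    · intro r hr; simp at hr ⊢; omega
    · intro r hr; simp at hr ⊢; omega
    · intro r hr; simp at hr ⊢; omega
    · intro r hr; simp at hr ⊢; omega
    · intro r hr; simp at hr
      have h1 : L - (L - r) = r := by omega
      have h2 : ((L - r : ℕ) : ℤ) = L - r := by omega
      rw [h1, h2]; congr 2; ring
  · congr 2
    have : ((L - M + 1 : ℕ) : ℤ) = L - M + 1 := by omega
    rw [this]; ring

theorem JT_geo (f : PowerSeries R) (a : R) (k : ℕ) (lam mu : ℕ → ℕ) (hl : ∀ i, lam (i + 1) ≤ lam i)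
    (hk : lam k = 0) :
    JT (f * geoS a) k lam mu = ∑ v ∈ Fintype.piFinset (fun i : Fin k => Icc (lam (i + 1)) (lam i)),
      a ^ (∑ i : Fin k, (lam i - v i)) * JT f k (ext0 v) mu := by
  set A : Matrix (Fin k) (Fin k) R :=
    Matrix.of fun i j : Fin k => zc (f * geoS a) ((lam i : ℤ) - (mu j : ℤ) - (i : ℤ) + (j : ℤ)) with hA
  set U : Matrix (Fin k) (Fin k) R :=
    Matrix.of fun i j : Fin k => if (j : ℕ) = i + 1 then a ^ (lam i - lam (i + 1) + 1) else 0 with hU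
  set B : Matrix (Fin k) (Fin k) R := fun i => ∑ v ∈ Icc (lam (i + 1)) (lam i),
    (fun j : Fin k => a ^ (lam i - v) * zc f ((v : ℤ) - (mu j : ℤ) - (i : ℤ) + (j : ℤ))) with hB
  have key : A = B + U * A := by
    ext i j
    rw [Matrix.add_apply, Matrix.mul_apply]
    have h1 := JT_rowsum f a (lam i) (lam (i + 1)) (hl i) ((mu j : ℤ) + (i : ℤ) - (j : ℤ))
    have h2 : ∀ z : ℤ, z - ((mu j : ℤ) + (i : ℤ) - (j : ℤ)) = z - mu j - i + j := fun z => by ring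
    simp only [h2] at h1
    rw [hA, Matrix.of_apply, h1]
    congr 1
    · simp [hB]
    · by_cases hi : (i : ℕ) + 1 < k
      · rw [Finset.sum_eq_single (⟨i + 1, hi⟩ : Fin k)]
        · simp only [hU, Matrix.of_apply, if_true]
          congr 2
          push_cast; ring
        · intro b _ hb
          simp only [hU, Matrix.of_apply]
          rw [if_neg, zero_mul]
          intro h; apply hb; ext; simp [h]
        · simp
      · have hi' : (i : ℕ) + 1 = k := by omega
        rw [hi', hk, zc_neg, mul_zero]
        · symm
          apply Finset.sum_eq_zero
          intro b _
          simp only [hU, Matrix.of_apply]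
          rw [if_neg (by omega), zero_mul]
        · have := j.2
          push_cast; omega
  have hdet : A.det = B.det := by
    have h1 : (1 - U) * A = B := by
      rw [sub_mul, one_mul]; nth_rewrite 1 [key]; simp
    rw [← h1, Matrix.det_mul]
    have : (1 - U).det = 1 := by
      rw [Matrix.det_of_isUpperTriangular]
      · apply Finset.prod_eq_one
        intro i _
        simp [hU]
      · intro i j hij
        simp only [id] at hij
        have : (j : ℕ) < i := hij
        simp only [hU, Matrix.sub_apply, Matrix.of_apply]
        rw [Matrix.one_apply_ne (by intro h; subst h; omega), if_neg (by omega)]; simp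
    rw [this, one_mul]
  unfold JT
  change A.det = _
  rw [hdet]
  change Matrix.detRowAlternating B = _
  rw [hB, ← AlternatingMap.coe_multilinearMap, MultilinearMap.map_sum_finset]
  apply Finset.sum_congr rfl
  intro v hv
  rw [← Finset.prod_pow_eq_pow_sum]
  have := Matrix.det_mul_column (fun i : Fin k => a ^ (lam i - v i))
    (Matrix.of fun i j : Fin k => zc f ((v i : ℤ) - (mu j : ℤ) - (i : ℤ) + (j : ℤ)))
  simp only [ext0_fin]
  rw [← this]
  rfl

theorem JT_one (k : ℕ) (lam mu : ℕ → ℕ) (hl : Antitone lam) (hm : Antitone mu) :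
    JT (1 : PowerSeries R) k lam mu = if ∀ i < k, lam i = mu i then 1 else 0 := by
  unfold JT
  simp only [zc_one]
  split_ifs with h
  · convert Matrix.det_one (n := Fin k) (R := R)
    ext i j
    rw [Matrix.of_apply, Matrix.one_apply, h i i.2]
    congr 1
    apply propext
    constructor
    · intro h1
      ext
      rcases lt_trichotomy (i : ℕ) j with h2 | h2 | h2
      · have := hm h2.le; omega
      · exact h2
      · have := hm h2.le; omega
    · rintro rfl; ring
  · have h' : ∃ i, i < k ∧ lam i ≠ mu i := by push Not at h; exact h
    classical
    have hs := Nat.find_spec h'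
    have hmin : ∀ j, j < Nat.find h' → lam j = mu j := by
      intro j hj
      have := Nat.find_min h' hj
      by_contra hc
      exact this ⟨by omega, hc⟩
    set i := Nat.find h'
    rcases lt_or_gt_of_ne hs.2 with h1 | h1
    · apply Matrix.det_eq_zero_of_column_eq_zero ⟨i, hs.1⟩
      intro j
      rw [Matrix.of_apply, if_neg]
      rcases lt_or_ge (j : ℕ) i with h2 | h2
      · have e1 := hmin _ h2
        have := hm h2.le
        simp; omega
      · have := hl h2
        simp; omega
    · apply Matrix.det_eq_zero_of_row_eq_zero ⟨i, hs.1⟩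
      intro j
      rw [Matrix.of_apply, if_neg]
      rcases lt_or_ge (j : ℕ) i with h2 | h2
      · have e1 := hmin _ h2
        have := hl h2.le
        simp; omega
      · have := hm h2
        simp; omega

end JT

theorem skewSchur_eq_JT (N k : ℕ) (lam mu : ℕ → ℕ) : skewSchur N k lam mu = JT (Hs N N) k lam mu := by
  unfold skewSchur JT
  simp only [homog_eq]

theorem JT_congr {R : Type*} [CommRing R] (f : PowerSeries R) (k : ℕ) (lam mu lam' mu' : ℕ → ℕ)
    (h1 : ∀ i < k, lam i = lam' i) (h2 : ∀ i < k, mu i = mu' i) : JT f k lam mu = JT f k lam' mu' := by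
  unfold JT
  congr 1
  ext i j
  rw [Matrix.of_apply, Matrix.of_apply, h1 i i.2, h2 j j.2]


structure IsPart (f : ℕ → ℕ) : Prop where
  anti : Antitone f
  fin : ∃ K, ∀ i, K ≤ i → f i = 0

theorem lt_conj {f : ℕ → ℕ} (hf : IsPart f) (i j : ℕ) : i < conjPart f j ↔ j < f i := by
  obtain ⟨K, hK⟩ := hf.fin
  have hex : ∃ i, f i ≤ j := ⟨K, by rw [hK K le_rfl]; omega⟩
  classical
  have hset : {i : ℕ | j + 1 ≤ f i} = Set.Iio (Nat.find hex) := by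
    ext i
    simp only [Set.mem_ofPred_eq, Set.mem_Iio, Nat.lt_find_iff]
    constructor
    · intro h m hm
      have := hf.anti hm; omega
    · intro h
      have := h i le_rfl; omega
  have : conjPart f j = Nat.find hex := by
    unfold conjPart
    rw [hset, ← Finset.coe_Iio, Set.ncard_coe_finset]; simp
  rw [this]
  have h2 : i ∈ {i : ℕ | j + 1 ≤ f i} ↔ i < Nat.find hex := by rw [hset]; rfl
  rw [← h2]; rfl

theorem isPart_conj {f : ℕ → ℕ} (hf : IsPart f) : IsPart (conjPart f) := by
  refine ⟨?_, f 0, ?_⟩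
  · intro a b hab
    by_contra hc
    push Not at hc
    have h1 := (lt_conj hf (conjPart f a) b).1 hc
    have h2 := (lt_conj hf (conjPart f a) a).2 (by omega)
    omega
  · intro i hi
    by_contra hc
    have := (lt_conj hf 0 i).1 (by omega)
    omega

theorem conj_conj {f : ℕ → ℕ} (hf : IsPart f) : conjPart (conjPart f) = f := by
  funext j
  apply le_antisymm
  · by_contra hc
    push Not at hc
    have := (lt_conj hf _ _).1 ((lt_conj (isPart_conj hf) _ _).1 hc)
    omega
  · by_contra hc
    push Not at hc
    have := (lt_conj (isPart_conj hf) _ _).2 ((lt_conj hf _ _).2 hc)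
    omega

theorem conj_zero_of_le {f : ℕ → ℕ} (hf : IsPart f) {C : ℕ} (h : ∀ i, f i ≤ C) (j : ℕ) (hj : C ≤ j) :
    conjPart f j = 0 := by
  by_contra hc
  have := (lt_conj hf 0 j).1 (by omega)
  have := h 0; omega

theorem conj_le_of_zero {f : ℕ → ℕ} (hf : IsPart f) {k : ℕ} (h : ∀ i, k ≤ i → f i = 0) (j : ℕ) :
    conjPart f j ≤ k := by
  by_contra hc
  have := (lt_conj hf k j).1 (by omega)
  have := h k le_rfl; omega

theorem sum_conj {f : ℕ → ℕ} (hf : IsPart f) {k C : ℕ} (hC : ∀ x, C ≤ x → f x = 0) (hk : ∀ x, f x ≤ k) :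
    ∑ i ∈ range k, conjPart f i = ∑ x ∈ range C, f x := by
  have h1 : ∀ i, conjPart f i = ∑ x ∈ range C, if i < f x then 1 else 0 := by
    intro i
    rw [← Finset.card_filter]
    have : (range C).filter (fun x => i < f x) = range (conjPart f i) := by
      ext x
      simp only [mem_filter, mem_range, lt_conj hf]
      constructor
      · exact fun h => h.2
      · intro h
        refine ⟨?_, h⟩
        by_contra hc
        have := hC x (by omega); omega
    rw [this, card_range]
  have h2 : ∀ x, f x = ∑ i ∈ range k, if i < f x then 1 else 0 := by
    intro x
    rw [← Finset.card_filter]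
    have : (range k).filter (fun i => i < f x) = range (f x) := by
      ext i
      have := hk x
      simp only [mem_filter, mem_range]; omega
    rw [this, card_range]
  rw [Finset.sum_congr rfl (fun i _ => h1 i), Finset.sum_comm]
  exact Finset.sum_congr rfl (fun x _ => (h2 x).symm)

structure Tab (N : ℕ) (m l : ℕ → ℕ) (α : ℕ → ℕ → ℕ) : Prop where
  anti : ∀ x y, α (x + 1) y ≤ α x y
  mono : ∀ x y, α x y ≤ α x (y + 1)
  step : ∀ x y, α x (y + 1) ≤ α x y + 1
  bot : ∀ x, α x 0 = m x
  top : ∀ x y, N ≤ y → α x y = l x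

theorem Tab.le_top {N : ℕ} {m l : ℕ → ℕ} {α : ℕ → ℕ → ℕ} (h : Tab N m l α) (x y : ℕ) : α x y ≤ l x := by
  have h1 : Monotone (α x) := monotone_nat_of_le_succ (h.mono x)
  rw [← h.top x (max y N) (le_max_right _ _)]
  exact h1 (le_max_left _ _)

theorem Tab.antitone {N : ℕ} {m l : ℕ → ℕ} {α : ℕ → ℕ → ℕ} (h : Tab N m l α) (y : ℕ) :
    Antitone (fun x => α x y) := antitone_nat_of_succ_le (fun x => h.anti x y)

theorem Tab.isPart {N : ℕ} {m l : ℕ → ℕ} {α : ℕ → ℕ → ℕ} (h : Tab N m l α) (hl : IsPart l) (y : ℕ) :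
    IsPart (fun x => α x y) := by
  refine ⟨h.antitone y, ?_⟩
  obtain ⟨K, hK⟩ := hl.fin
  refine ⟨K, fun i hi => ?_⟩
  have := h.le_top i y
  rw [hK i hi] at this
  simpa using this

theorem Tab.finite (N : ℕ) (m l : ℕ → ℕ) (hl : IsPart l) : {α | Tab N m l α}.Finite := by
  obtain ⟨C, hC⟩ := hl.fin
  apply Set.Finite.of_finite_image
    (f := fun α => fun (x : Fin C) (y : Fin (N + 1)) => α x y)
  · apply (Set.finite_Icc (0 : Fin C → Fin (N + 1) → ℕ) (fun _ _ => l 0)).subset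
    rintro _ ⟨α, hα, rfl⟩
    refine ⟨fun _ _ => Nat.zero_le _, fun x y => ?_⟩
    exact (hα.le_top x y).trans (hl.anti (Nat.zero_le _))
  · intro α hα β hβ hab
    funext x y
    by_cases hx : x < C
    · have h1 := fun z : Fin (N + 1) => congrFun (congrFun hab ⟨x, hx⟩) z
      simp only at h1
      by_cases hy : y < N + 1
      · exact h1 ⟨y, hy⟩
      · rw [hα.top x y (by omega), hβ.top x y (by omega)]
    · have h1 := hα.le_top x y
      have h2 := hβ.le_top x y
      rw [hC x (by omega)] at h1 h2
      omega

noncomputable def tabF (N : ℕ) (m l : ℕ → ℕ) (hl : IsPart l) : Finset (ℕ → ℕ → ℕ) := (Tab.finite N m l hl).toFinset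

theorem mem_tabF {N : ℕ} {m l : ℕ → ℕ} {hl : IsPart l} {α : ℕ → ℕ → ℕ} : α ∈ tabF N m l hl ↔ Tab N m l α := by
  simp [tabF]

def tinc (C : ℕ) (α : ℕ → ℕ → ℕ) (y : ℕ) : ℕ := ∑ x ∈ range C, (α x (y + 1) - α x y)

section
variable {R : Type*} [CommRing R]

theorem JT_tab (v : ℕ → R) (k C : ℕ) (m : ℕ → ℕ) (hm : IsPart m) (hmk : ∀ x, m x ≤ k) (n : ℕ) :
    ∀ (l : ℕ → ℕ) (hl : IsPart l) (hlC : ∀ x, C ≤ x → l x = 0) (hlk : ∀ x, l x ≤ k),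
    JT (∏ y ∈ range n, geoS (v y)) k (conjPart l) (conjPart m) =
      ∑ α ∈ tabF n m l hl, ∏ y ∈ range n, v y ^ tinc C α y := by
  induction n with
  | zero =>
    intro l hl hlC hlk
    rw [prod_range_zero, JT_one _ _ _ (isPart_conj hl).anti (isPart_conj hm).anti]
    simp only [prod_range_zero, sum_const, nsmul_one]
    split_ifs with h
    · have hlm : l = m := by
        rw [← conj_conj hl, ← conj_conj hm]
        congr 1
        funext i
        by_cases hi : i < k
        · exact h i hi
        · rw [conj_zero_of_le hl hlk i (by omega), conj_zero_of_le hm hmk i (by omega)]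
      have : tabF 0 m l hl = {fun x _ => l x} := by
        ext α
        rw [mem_tabF, mem_singleton]
        constructor
        · intro h; funext x y; exact h.top x y (by omega)
        · rintro rfl
          exact ⟨fun x _ => hl.anti (by omega), fun _ _ => le_rfl, fun _ _ => by omega,
            fun x => by rw [hlm], fun _ _ _ => rfl⟩
      rw [this]; simp
    · have : tabF 0 m l hl = ∅ := by
        rw [Finset.eq_empty_iff_forall_notMem]
        intro α hα
        rw [mem_tabF] at hα
        apply h
        have : l = m := by
          funext x
          rw [← hα.bot, hα.top x 0 (by omega)]
        intro i _; rw [this]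
      rw [this]; simp
  | succ n ih =>
    intro l hl hlC hlk
    have hcl := isPart_conj hl
    have hclk : ∀ i, k ≤ i → conjPart l i = 0 := fun i hi => conj_zero_of_le hl hlk i hi
    rw [prod_range_succ, JT_geo _ _ _ _ _ (fun i => hcl.anti (by omega)) (hclk k le_rfl)]
    -- properties of ν
    have hν : ∀ ν ∈ Fintype.piFinset (fun i : Fin k => Icc (conjPart l (i + 1)) (conjPart l i)),
        IsPart (ext0 ν) ∧ (∀ x, k ≤ x → ext0 ν x = 0) ∧ (∀ i, ext0 ν i ≤ conjPart l i) ∧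
          (∀ i, conjPart l (i + 1) ≤ ext0 ν i) := by
      intro ν hν
      rw [Fintype.mem_piFinset] at hν
      have h0 : ∀ x, k ≤ x → ext0 ν x = 0 := by
        intro x hx; simp [ext0, not_lt.mpr hx]
      have h1 : ∀ i, ext0 ν i ≤ conjPart l i := by
        intro i
        by_cases hi : i < k
        · have := hν ⟨i, hi⟩
          rw [mem_Icc] at this
          simpa [ext0, hi] using this.2
        · rw [h0 i (by omega)]; omega
      have h2 : ∀ i, conjPart l (i + 1) ≤ ext0 ν i := by
        intro i
        by_cases hi : i < k
        · have := hν ⟨i, hi⟩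
          rw [mem_Icc] at this
          simpa [ext0, hi] using this.1
        · rw [hclk (i + 1) (by omega)]; omega
      exact ⟨⟨antitone_nat_of_succ_le fun i => (h1 _).trans (h2 _), k, h0⟩, h0, h1, h2⟩
    have hu : ∀ ν ∈ Fintype.piFinset (fun i : Fin k => Icc (conjPart l (i + 1)) (conjPart l i)),
        IsPart (conjPart (ext0 ν)) ∧ (∀ x, conjPart (ext0 ν) x ≤ l x) ∧
          (∀ x, l x ≤ conjPart (ext0 ν) x + 1) := by
      intro ν hνm
      obtain ⟨hp, h0, h1, h2⟩ := hν ν hνm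
      refine ⟨isPart_conj hp, fun x => ?_, fun x => ?_⟩
      · by_contra hc
        push Not at hc
        have e1 := (lt_conj hp _ _).1 hc
        have e2 := (lt_conj hl _ _).1 (lt_of_lt_of_le e1 (h1 _))
        omega
      · by_contra hc
        push Not at hc
        have e1 := (lt_conj hl _ _).2 hc
        have e2 := (lt_conj hp _ _).2 (lt_of_lt_of_le e1 (h2 _))
        omega
    have hstep : ∀ ν ∈ Fintype.piFinset (fun i : Fin k => Icc (conjPart l (i + 1)) (conjPart l i)),
        v n ^ (∑ i : Fin k, (conjPart l i - ν i)) * JT (∏ y ∈ range n, geoS (v y)) k (ext0 ν) (conjPart m)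
        = ∑ α ∈ (Set.Finite.toFinset (s := {α | Tab n m (conjPart (ext0 ν)) α}) (by
            by_cases h : IsPart (conjPart (ext0 ν))
            · exact Tab.finite n m _ h
            · apply Set.Finite.subset (Set.finite_singleton (fun _ _ => 0))
              intro α hα
              exfalso; apply h
              have := hα
              refine ⟨?_, ?_⟩
              · have h1 := hα.antitone n
                have : (fun x => α x n) = conjPart (ext0 ν) := by funext x; exact hα.top x n le_rfl
                rwa [this] at h1
              · refine ⟨∑ i : Fin k, ν i, fun x hx => ?_⟩
                unfold conjPart
                convert Set.ncard_empty ℕ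
                ext i
                simp only [Set.mem_ofPred_eq, Set.mem_empty_iff_false, iff_false, not_le]
                unfold ext0
                split_ifs with hi
                · have := Finset.single_le_sum (f := ν) (fun _ _ => Nat.zero_le _) (mem_univ ⟨i, hi⟩)
                  omega
                · omega)),
          v n ^ (∑ x ∈ range C, (l x - conjPart (ext0 ν) x)) * ∏ y ∈ range n, v y ^ tinc C α y := by
      intro ν hνm
      obtain ⟨hp, h0, h1, h2⟩ := hν ν hνm
      obtain ⟨up, u1, u2⟩ := hu ν hνm
      have hconj := conj_conj hp
      have hJ := ih (conjPart (ext0 ν)) up (fun x hx => by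
        have := u1 x; have := hlC x hx; omega) (fun x => (u1 x).trans (hlk x))
      rw [hconj] at hJ
      rw [hJ, Finset.mul_sum]
      have hw : ∑ i : Fin k, (conjPart l i - ν i) = ∑ x ∈ range C, (l x - conjPart (ext0 ν) x) := by
        have e1 := sum_conj hl hlC hlk
        have e2 := sum_conj up (C := C) (k := k) (fun x hx => by
          have := u1 x; have := hlC x hx; omega) (fun x => (u1 x).trans (hlk x))
        rw [hconj] at e2
        have e3 : ∑ i : Fin k, (conjPart l i - ν i) = ∑ i ∈ range k, (conjPart l i - ext0 ν i) := by
          rw [← Fin.sum_univ_eq_sum_range (fun i => conjPart l i - ext0 ν i)]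
          simp [ext0]
        rw [e3, Finset.sum_tsub_distrib _ (fun i _ => h1 i), Finset.sum_tsub_distrib _ (fun i _ => u1 i), e1, e2]
      rw [hw]
      rfl
    rw [Finset.sum_congr rfl hstep, Finset.sum_sigma']
    symm
    refine Finset.sum_bij'
      (fun α _ => ⟨fun i : Fin k => conjPart (fun x => α x n) i, fun x y => α x (min y n)⟩)
      (fun p _ => fun x y => if y ≤ n then p.2 x y else l x) ?_ ?_ ?_ ?_ ?_
    · intro α hα
      rw [mem_tabF] at hα
      have hp := hα.isPart hl n
      have hk : ∀ x, α x n ≤ k := fun x => (hα.le_top x n).trans (hlk x)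
      have hext : ext0 (fun i : Fin k => conjPart (fun x => α x n) i) = conjPart (fun x => α x n) := by
        funext i
        unfold ext0
        split_ifs with hi
        · rfl
        · rw [conj_zero_of_le hp hk i (by omega)]
      have htop : ∀ x, α x (n + 1) = l x := fun x => hα.top x _ le_rfl
      rw [mem_sigma]
      constructor
      · rw [Fintype.mem_piFinset]
        intro i
        rw [mem_Icc]
        constructor
        · simp only
          by_contra hc
          push Not at hc
          have e1 := (lt_conj hl _ _).1 hc
          have e2 := (lt_conj hp (conjPart (fun x => α x n) i) i).2 (by
            have := hα.step (conjPart (fun x => α x n) i) n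
            rw [htop] at this
            omega)
          omega
        · simp only
          by_contra hc
          push Not at hc
          have e1 := (lt_conj hp _ _).1 hc
          have e2 := (lt_conj hl (conjPart l i) i).2 (by
            have := hα.le_top (conjPart l i) n
            omega)
          omega
      · rw [Set.Finite.mem_toFinset, Set.mem_ofPred_eq, hext, conj_conj hp]
        refine ⟨fun x y => hα.anti x _, fun x y => ?_, fun x y => ?_, fun x => ?_, fun x y hy => ?_⟩
        · exact (monotone_nat_of_le_succ (hα.mono x)) (by omega)
        · have : min (y + 1) n = min y n ∨ min (y + 1) n = min y n + 1 := by omega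
          dsimp only
          rcases this with h | h <;> rw [h]
          · omega
          · exact hα.step _ _
        · simp [hα.bot]
        · dsimp only
          rw [min_eq_right hy]
    · rintro ⟨ν, α⟩ hp
      rw [mem_sigma, Set.Finite.mem_toFinset, Set.mem_ofPred_eq] at hp
      obtain ⟨hνm, hα⟩ := hp
      simp only at hνm hα ⊢
      obtain ⟨up, u1, u2⟩ := hu ν hνm
      rw [mem_tabF]
      refine ⟨fun x y => ?_, fun x y => ?_, fun x y => ?_, fun x => ?_, fun x y hy => ?_⟩
      · split_ifs
        · exact hα.anti x y
        · exact hl.anti (by omega)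
      · split_ifs
        · exact hα.mono x y
        · exact (hα.le_top x y).trans (u1 x)
        · omega
        · exact le_rfl
      · split_ifs with g1 g2 g2
        · exact hα.step x y
        · omega
        · have : y = n := by omega
          rw [this, hα.top x n le_rfl]
          exact u2 x
        · omega
      · simp [hα.bot]
      · rw [if_neg (by omega)]
    · intro α hα
      rw [mem_tabF] at hα
      funext x y
      dsimp only
      split_ifs with h
      · rw [min_eq_left h]
      · rw [hα.top x y (by omega)]
    · rintro ⟨ν, α⟩ hp
      rw [mem_sigma, Set.Finite.mem_toFinset, Set.mem_ofPred_eq] at hp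
      obtain ⟨hνm, hα⟩ := hp
      simp only at hνm hα ⊢
      obtain ⟨hp, h0, h1, h2⟩ := hν ν hνm
      have e1 : (fun i : Fin k => conjPart (fun x => if n ≤ n then α x n else l x) i) = ν := by
        funext i
        have : (fun x => if n ≤ n then α x n else l x) = conjPart (ext0 ν) := by
          funext x; rw [if_pos le_rfl, hα.top x n le_rfl]
        rw [this, conj_conj hp, ext0_fin]
      have e2 : (fun x y => if min y n ≤ n then α x (min y n) else l x) = α := by
        funext x y
        rw [if_pos (min_le_right _ _)]
        by_cases hy : y ≤ n
        · rw [min_eq_left hy]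
        · rw [min_eq_right (by omega), hα.top x n le_rfl, hα.top x y (by omega)]
      rw [e1, e2]
    · intro α hα
      rw [mem_tabF] at hα
      have hp := hα.isPart hl n
      have hk : ∀ x, α x n ≤ k := fun x => (hα.le_top x n).trans (hlk x)
      have hext : ext0 (fun i : Fin k => conjPart (fun x => α x n) i) = conjPart (fun x => α x n) := by
        funext i
        unfold ext0
        split_ifs with hi
        · rfl
        · rw [conj_zero_of_le hp hk i (by omega)]
      rw [prod_range_succ, mul_comm]
      dsimp only
      rw [hext, conj_conj hp]
      congr 1
      · unfold tinc
        simp only [hα.top _ (n + 1) le_rfl]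
      · apply Finset.prod_congr rfl
        intro y hy
        rw [mem_range] at hy
        unfold tinc
        simp only [min_eq_left hy.le, min_eq_left (Nat.succ_le_of_lt hy)]

end

theorem skewSchur_tab (N k C : ℕ) (lam mu : ℕ → ℕ) (hl : IsPart lam) (hm : IsPart mu)
    (hlk : ∀ i, k ≤ i → lam i = 0) (hmk : ∀ i, k ≤ i → mu i = 0) (hC : ∀ i, lam i ≤ C) :
    skewSchur N k lam mu = ∑ α ∈ tabF N (conjPart mu) (conjPart lam) (isPart_conj hl),
      ∏ y : Fin N, MvPolynomial.X y ^ tinc C α y := by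
  have := JT_tab (varN N) k C (conjPart mu) (isPart_conj hm) (fun x => conj_le_of_zero hm hmk x) N
    (conjPart lam) (isPart_conj hl) (fun x hx => conj_zero_of_le hl hC x hx) (fun x => conj_le_of_zero hl hlk x)
  rw [conj_conj hl, conj_conj hm] at this
  rw [skewSchur_eq_JT, Hs, this]
  apply Finset.sum_congr rfl
  intro α _
  rw [← Fin.prod_univ_eq_prod_range (fun y => varN N y ^ tinc C α y) N]
  simp [varN]


noncomputable def alt (N : ℕ) (g : Fin N → ℕ) : MvPolynomial (Fin N) ℤ :=
  Matrix.det (Matrix.of fun i j : Fin N => (MvPolynomial.X j : MvPolynomial (Fin N) ℤ) ^ g i)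

def dlt (N : ℕ) (i : Fin N) : ℕ := N - 1 - i

noncomputable def Epoly (N : ℕ) (j : Fin N) : Polynomial (MvPolynomial (Fin N) ℤ) :=
  ∏ l ∈ univ.erase j, (1 - Polynomial.C (MvPolynomial.X l) * Polynomial.X)

theorem Epoly_coeff (N : ℕ) (j : Fin N) (r : ℕ) (hr : N ≤ r) : (Epoly N j).coeff r = 0 := by
  apply Polynomial.coeff_eq_zero_of_natDegree_lt
  have h1 : (Epoly N j).natDegree ≤ ∑ l ∈ univ.erase j, 1 := by
    refine (Polynomial.natDegree_prod_le _ _).trans (Finset.sum_le_sum fun l _ => ?_)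
    refine (Polynomial.natDegree_sub_le _ _).trans ?_
    simp only [Polynomial.natDegree_one]
    refine max_le (by omega) ((Polynomial.natDegree_C_mul_le _ _).trans Polynomial.natDegree_X_le)
  have := j.2
  simp at h1
  omega

theorem Hs_mul_Epoly (N : ℕ) (j : Fin N) : Hs N N * (Epoly N j : PowerSeries (MvPolynomial (Fin N) ℤ))
    = geoS (MvPolynomial.X j) := by
  have h1 : (Epoly N j : PowerSeries (MvPolynomial (Fin N) ℤ)) =
      ∏ l ∈ univ.erase j, (1 - PowerSeries.C (MvPolynomial.X l) * PowerSeries.X) := by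
    change Polynomial.coeToPowerSeries.ringHom (Epoly N j) = _
    unfold Epoly
    rw [map_prod]
    apply Finset.prod_congr rfl
    intro l _
    simp
  rw [h1, Hs_fin, ← Finset.mul_prod_erase _ _ (mem_univ j), mul_assoc, ← Finset.prod_mul_distrib,
    Finset.prod_congr rfl (fun l _ => geoS_mul _), Finset.prod_const_one, mul_one]

theorem alt_eq_aux (N : ℕ) : ∃ D : MvPolynomial (Fin N) ℤ, ∀ κ : ℕ → ℕ,
    alt N (fun i => κ i + dlt N i) = skewSchur N N κ (fun _ => 0) * D := by
  refine ⟨Matrix.det (Matrix.of fun s j : Fin N => (Epoly N j).coeff (N - 1 - s)), fun κ => ?_⟩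
  unfold alt skewSchur
  rw [← Matrix.det_mul]
  congr 1
  ext1 i j
  rw [Matrix.mul_apply]
  simp only [Matrix.of_apply]
  have h1 : (MvPolynomial.X j : MvPolynomial (Fin N) ℤ) ^ (κ i + dlt N i)
      = PowerSeries.coeff (κ i + dlt N i) (geoS (MvPolynomial.X j : MvPolynomial (Fin N) ℤ)) := by
    simp [geoS]
  rw [h1, ← Hs_mul_Epoly, PowerSeries.coeff_mul]
  rw [Finset.Nat.sum_antidiagonal_eq_sum_range_succ (fun a b => PowerSeries.coeff a (Hs N N) *
    PowerSeries.coeff b (Epoly N j : PowerSeries (MvPolynomial (Fin N) ℤ)))]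
  set m := κ i + dlt N i with hm
  have hi := i.2
  have h2 : ∑ r ∈ range (m + 1), PowerSeries.coeff r (Hs N N) *
    PowerSeries.coeff (m - r) (Epoly N j : PowerSeries (MvPolynomial (Fin N) ℤ)) =
    ∑ r ∈ range (m + 1), zc (Hs N N) ((m : ℤ) - r) * (Epoly N j).coeff r := by
    rw [← Finset.sum_range_reflect]
    apply Finset.sum_congr rfl
    intro r hr
    rw [mem_range] at hr
    rw [Polynomial.coeff_coe]
    unfold zc
    have e1 : m + 1 - 1 - r = m - r := by omega
    have e2 : m - (m - r) = r := by omega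
    have e3 : ((m : ℤ) - r).toNat = m - r := by omega
    rw [if_pos (by omega), e1, e2, e3]
  rw [h2]
  have h3 : ∑ r ∈ range (m + 1), zc (Hs N N) ((m : ℤ) - r) * (Epoly N j).coeff r
    = ∑ r ∈ range (max N (m + 1)), zc (Hs N N) ((m : ℤ) - r) * (Epoly N j).coeff r := by
    apply Finset.sum_subset
    · intro r; simp; omega
    · intro r hr1 hr2
      simp at hr1 hr2
      rw [zc_neg _ _ (by omega), zero_mul]
  have h4 : ∑ r ∈ range N, zc (Hs N N) ((m : ℤ) - r) * (Epoly N j).coeff r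
    = ∑ r ∈ range (max N (m + 1)), zc (Hs N N) ((m : ℤ) - r) * (Epoly N j).coeff r := by
    apply Finset.sum_subset
    · intro r; simp; omega
    · intro r hr1 hr2
      simp at hr1 hr2
      rw [Epoly_coeff _ _ _ hr2, mul_zero]
  rw [h3, ← h4, ← Finset.sum_range_reflect, ← Fin.sum_univ_eq_sum_range
    (fun r => zc (Hs N N) ((m : ℤ) - (N - 1 - r : ℕ)) * (Epoly N j).coeff (N - 1 - r))]
  apply Finset.sum_congr rfl
  intro s _
  rw [homog_eq]
  congr 2
  have := s.2
  rw [hm, dlt]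
  push_cast
  omega

theorem skewSchur_zero (N : ℕ) : skewSchur N N (fun _ => 0) (fun _ => 0) = 1 := by
  unfold skewSchur
  rw [Matrix.det_of_isUpperTriangular]
  · apply Finset.prod_eq_one
    intro i _
    simp [homog]
  · intro i j hij
    have : (j : ℕ) < i := hij
    rw [Matrix.of_apply, homog, if_neg]
    push_cast; omega

theorem alt_eq (N : ℕ) (κ : ℕ → ℕ) :
    alt N (fun i => κ i + dlt N i) = alt N (dlt N) * skewSchur N N κ (fun _ => 0) := by
  obtain ⟨D, hD⟩ := alt_eq_aux N
  have h0 := hD (fun _ => 0)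
  rw [skewSchur_zero, one_mul] at h0
  simp only [zero_add] at h0
  rw [hD, ← h0, mul_comm]

theorem alt_dlt_ne (N : ℕ) : alt N (dlt N) ≠ 0 := by
  have h : (Matrix.of fun i j : Fin N => (MvPolynomial.X j : MvPolynomial (Fin N) ℤ) ^ dlt N i)
      = (Matrix.vandermonde (fun j : Fin N => (MvPolynomial.X j : MvPolynomial (Fin N) ℤ))).transpose.submatrix
        (Fin.revPerm) id := by
    ext1 i j
    simp only [Matrix.of_apply, Matrix.submatrix_apply, Matrix.transpose_apply, Matrix.vandermonde_apply, id]
    congr 1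
    simp [dlt]; omega
  unfold alt
  rw [h, Matrix.det_permute, Matrix.det_transpose]
  have h2 := Matrix.det_vandermonde_ne_zero_iff.2 (MvPolynomial.X_injective (σ := Fin N) (R := ℤ))
  rcases Int.units_eq_one_or (Equiv.Perm.sign (Fin.revPerm (n := N))) with h3 | h3 <;> rw [h3] <;> simpa using h2

theorem alt_expand (N : ℕ) (g : Fin N → ℕ) : alt N g = ∑ σ : Equiv.Perm (Fin N),
    (Equiv.Perm.sign σ : ℤ) • MvPolynomial.rename σ (∏ i : Fin N, (MvPolynomial.X i : MvPolynomial (Fin N) ℤ) ^ g i) := by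
  unfold alt
  rw [← Matrix.det_transpose, Matrix.det_apply]
  apply Finset.sum_congr rfl
  intro σ _
  rw [map_prod]
  simp [Units.smul_def]

theorem alt_mul_sum (N : ℕ) {ι : Type*} (F : Finset ι) (w : ι → Fin N → ℕ) (f : MvPolynomial (Fin N) ℤ)
    (hf : f = ∑ o ∈ F, ∏ y : Fin N, MvPolynomial.X y ^ w o y) (hs : f.IsSymmetric) :
    alt N (dlt N) * f = ∑ o ∈ F, alt N (fun y => w o y + dlt N y) := by
  rw [alt_expand, Finset.sum_mul]
  have h : ∀ σ : Equiv.Perm (Fin N), ((Equiv.Perm.sign σ : ℤ) • MvPolynomial.rename σ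
      (∏ i : Fin N, (MvPolynomial.X i : MvPolynomial (Fin N) ℤ) ^ dlt N i)) * f
      = ∑ o ∈ F, (Equiv.Perm.sign σ : ℤ) • MvPolynomial.rename σ
      (∏ i : Fin N, (MvPolynomial.X i : MvPolynomial (Fin N) ℤ) ^ (w o i + dlt N i)) := by
    intro σ
    rw [← hs σ, smul_mul_assoc, ← map_mul, hf, Finset.mul_sum, map_sum, Finset.smul_sum]
    apply Finset.sum_congr rfl
    intro o _
    rw [← Finset.prod_mul_distrib]
    congr 3
    funext i
    rw [pow_add, mul_comm]
  rw [Finset.sum_congr rfl (fun σ _ => h σ), Finset.sum_comm]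
  apply Finset.sum_congr rfl
  intro o _
  rw [alt_expand]

theorem alt_swap (N : ℕ) (g g' : Fin N → ℕ) (a b : Fin N) (hab : a ≠ b)
    (hg : ∀ i, g' i = g (Equiv.swap a b i)) : alt N g + alt N g' = 0 := by
  have : alt N g' = - alt N g := by
    unfold alt
    have h : (Matrix.of fun i j : Fin N => (MvPolynomial.X j : MvPolynomial (Fin N) ℤ) ^ g' i) =
      (Matrix.of fun i j : Fin N => (MvPolynomial.X j : MvPolynomial (Fin N) ℤ) ^ g i).submatrix (Equiv.swap a b) id := by
      ext1 i j
      simp [hg]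
    rw [h, Matrix.det_permute, Equiv.Perm.sign_swap hab]
    simp
  rw [this]; ring

theorem homog_symm (N : ℕ) (m : ℤ) : (homog N m).IsSymmetric := by
  unfold homog
  split_ifs
  · exact MvPolynomial.hsymm_isSymmetric _ _ _
  · exact MvPolynomial.IsSymmetric.zero

theorem skewSchur_symm (N k : ℕ) (lam mu : ℕ → ℕ) : (skewSchur N k lam mu).IsSymmetric := by
  intro σ
  unfold skewSchur
  rw [AlgHom.map_det]
  congr 1
  ext1 i j
  simp only [AlgHom.mapMatrix_apply, Matrix.map_apply, Matrix.of_apply]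
  exact homog_symm N _ σ


structure Arr (α : ℕ → ℕ → ℕ) : Prop where
  anti : ∀ x y, α (x + 1) y ≤ α x y
  mono : ∀ x y, α x y ≤ α x (y + 1)
  step : ∀ x y, α x (y + 1) ≤ α x y + 1

theorem Arr.antitone {α : ℕ → ℕ → ℕ} (h : Arr α) (y : ℕ) {x x' : ℕ} (hx : x ≤ x') : α x' y ≤ α x y :=
  (antitone_nat_of_succ_le (f := fun x => α x y) (fun x => h.anti x y)) hx

theorem Arr.mono2 {α : ℕ → ℕ → ℕ} (h : Arr α) (x y : ℕ) : α x (y + 1) ≤ α x (y + 2) := h.mono x (y + 1)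
theorem Arr.step2 {α : ℕ → ℕ → ℕ} (h : Arr α) (x y : ℕ) : α x (y + 2) ≤ α x (y + 1) + 1 := h.step x (y + 1)

theorem card_filter_dc (c : ℕ) (P : ℕ → Prop) [DecidablePred P] (hP : ∀ x x', x ≤ x' → P x' → P x) (x : ℕ)
    (hx : x < c) : x < ((range c).filter P).card ↔ P x := by
  constructor
  · intro h
    by_contra hc
    have : (range c).filter P ⊆ range x := by
      intro z hz
      rw [mem_filter] at hz
      rw [mem_range]
      by_contra hzx
      exact hc (hP x z (by omega) hz.2)
    have := card_le_card this
    rw [card_range] at this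
    omega
  · intro h
    have : range (x + 1) ⊆ (range c).filter P := by
      intro z hz
      rw [mem_range] at hz
      rw [mem_filter, mem_range]
      exact ⟨by omega, hP z x (by omega) h⟩
    have := card_le_card this
    rw [card_range] at this
    omega

def clt (g : ℕ → ℕ) (c v : ℕ) : ℕ := ((range c).filter (fun x => v < g x)).card
def cle (g : ℕ → ℕ) (c v : ℕ) : ℕ := ((range c).filter (fun x => v ≤ g x)).card

def rho (g : ℕ → ℕ) (c x : ℕ) : ℕ := clt g c (g x) + cle g c (g x) - 1 - x

section
variable {g : ℕ → ℕ}

theorem clt_iff (hg : ∀ x x', x ≤ x' → g x' ≤ g x) (c : ℕ) (v x : ℕ) (hx : x < c) : x < clt g c v ↔ v < g x :=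
  card_filter_dc c (fun x => v < g x) (fun x x' h h' => lt_of_lt_of_le h' (hg x x' h)) x hx

theorem cle_iff (hg : ∀ x x', x ≤ x' → g x' ≤ g x) (c : ℕ) (v x : ℕ) (hx : x < c) : x < cle g c v ↔ v ≤ g x :=
  card_filter_dc c (fun x => v ≤ g x) (fun x x' h h' => le_trans h' (hg x x' h)) x hx

theorem cle_le (c : ℕ) (v : ℕ) : cle g c v ≤ c := by
  unfold cle
  exact (card_filter_le _ _).trans (by simp)

theorem rho_bounds (hg : ∀ x x', x ≤ x' → g x' ≤ g x) (c : ℕ) (x : ℕ) (hx : x < c) : clt g c (g x) ≤ x ∧ x < cle g c (g x) ∧ cle g c (g x) ≤ c := by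
  refine ⟨?_, ?_, cle_le c _⟩
  · by_contra hc
    have := (clt_iff hg c (g x) x hx).1 (by omega)
    omega
  · exact (cle_iff hg c (g x) x hx).2 le_rfl

theorem rho_lt (hg : ∀ x x', x ≤ x' → g x' ≤ g x) (c : ℕ) (x : ℕ) (hx : x < c) : rho g c x < c := by
  have := rho_bounds hg c x hx
  unfold rho; omega

theorem g_rho (hg : ∀ x x', x ≤ x' → g x' ≤ g x) (c : ℕ) (x : ℕ) (hx : x < c) : g (rho g c x) = g x := by
  have h := rho_bounds hg c x hx
  have hl := rho_lt hg c x hx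
  have h1 := (cle_iff hg c (g x) _ hl).1 (by unfold rho; omega)
  have h2 := (clt_iff hg c (g x) _ hl).not.1 (by unfold rho; omega)
  omega

theorem rho_rho (hg : ∀ x x', x ≤ x' → g x' ≤ g x) (c : ℕ) (x : ℕ) (hx : x < c) : rho g c (rho g c x) = x := by
  have h := rho_bounds hg c x hx
  have e := g_rho hg c x hx
  rw [rho, e]
  unfold rho
  omega

theorem rho_succ (c : ℕ) (x : ℕ) (h : g (x + 1) = g x) : rho g c (x + 1) ≤ rho g c x := by
  unfold rho
  rw [h]; omega

end

/-- the Bender-Knuth type toggle at level `i+1` on the columns `< c` -/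
def tog (α : ℕ → ℕ → ℕ) (i c : ℕ) : ℕ → ℕ → ℕ := fun x y =>
  if y = i + 1 ∧ x < c then α x i + α x (i + 2) - α (rho (fun x => α x i + α x (i + 2)) c x) (i + 1)
  else α x y

theorem tog_of_ne (α : ℕ → ℕ → ℕ) (i c x y : ℕ) (h : y ≠ i + 1) : tog α i c x y = α x y := by
  simp [tog, h]

theorem tog_of_ge (α : ℕ → ℕ → ℕ) (i c x y : ℕ) (h : c ≤ x) : tog α i c x y = α x y := by
  simp [tog, not_lt.mpr h]

theorem tog_at (α : ℕ → ℕ → ℕ) (i c x : ℕ) (h : x < c) : tog α i c x (i + 1) =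
    α x i + α x (i + 2) - α (rho (fun x => α x i + α x (i + 2)) c x) (i + 1) := by
  simp [tog, h]

section
variable {α : ℕ → ℕ → ℕ}

theorem gsum_anti (hα : Arr α) (i : ℕ) : ∀ x x', x ≤ x' → (fun x => α x i + α x (i + 2)) x' ≤ (fun x => α x i + α x (i + 2)) x := by
  intro x x' h
  have := hα.antitone i h
  have := hα.antitone (i + 2) h
  dsimp only; omega

theorem fiber_eq (hα : Arr α) (i : ℕ) (x x' : ℕ) (h : α x i + α x (i + 2) = α x' i + α x' (i + 2)) :
    α x i = α x' i ∧ α x (i + 2) = α x' (i + 2) := by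
  rcases le_total x x' with h1 | h1
  · have := hα.antitone i h1
    have := hα.antitone (i + 2) h1
    omega
  · have := hα.antitone i h1
    have := hα.antitone (i + 2) h1
    omega

/-- values at `rho x` -/
theorem rho_vals (hα : Arr α) (i c : ℕ) (x : ℕ) (hx : x < c) :
    α (rho (fun x => α x i + α x (i + 2)) c x) i = α x i ∧
    α (rho (fun x => α x i + α x (i + 2)) c x) (i + 2) = α x (i + 2) :=
  fiber_eq hα i _ _ (g_rho (gsum_anti hα i) c x hx)

theorem tog_bounds (hα : Arr α) (i c : ℕ) (x : ℕ) (hx : x < c) : α x i ≤ tog α i c x (i + 1) ∧ tog α i c x (i + 1) ≤ α x i + 1 ∧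
    tog α i c x (i + 1) ≤ α x (i + 2) ∧ α x (i + 2) ≤ tog α i c x (i + 1) + 1 := by
  rw [tog_at α i c x hx]
  obtain ⟨h1, h2⟩ := rho_vals hα i c x hx
  have := hα.mono (rho (fun x => α x i + α x (i + 2)) c x) i
  have := hα.mono2 (rho (fun x => α x i + α x (i + 2)) c x) i
  have := hα.step (rho (fun x => α x i + α x (i + 2)) c x) i
  have := hα.step2 (rho (fun x => α x i + α x (i + 2)) c x) i
  omega

theorem tog_arr (hα : Arr α) (i c : ℕ) (hglue : ∀ x, x + 1 = c → ¬ (α x i = α (x + 1) i ∧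
    α (x + 1) (i + 1) = α (x + 1) i + 1 ∧ α (x + 1) (i + 2) = α (x + 1) i + 1)) : Arr (tog α i c) := by
  have hbd : ∀ x, α x i ≤ tog α i c x (i + 1) ∧ tog α i c x (i + 1) ≤ α x i + 1 ∧
    tog α i c x (i + 1) ≤ α x (i + 2) ∧ α x (i + 2) ≤ tog α i c x (i + 1) + 1 := by
    intro x
    by_cases hx : x < c
    · exact tog_bounds hα i c x hx
    · rw [tog_of_ge _ _ _ _ _ (by omega)]
      have := hα.mono x i
      have := hα.mono2 x i
      have := hα.step x i
      have := hα.step2 x i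
      omega
  refine ⟨fun x y => ?_, fun x y => ?_, fun x y => ?_⟩
  · by_cases hy : y = i + 1
    · subst hy
      have b1 := hbd x
      have b2 := hbd (x + 1)
      have a1 := hα.anti x i
      have a2 := hα.anti x (i + 2)
      by_cases hg : α x i + α x (i + 2) = α (x + 1) i + α (x + 1) (i + 2)
      · by_cases hx : x + 1 < c
        · rw [tog_at _ _ _ _ hx, tog_at _ _ _ _ (by omega), hg]
          have := hα.antitone (i + 1) (rho_succ (g := fun x => α x i + α x (i + 2)) c x hg.symm)
          omega
        · by_cases hx2 : x + 1 = c
          · have := hglue x hx2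
            rw [tog_of_ge _ _ _ (x + 1) _ (by omega)] at b2 ⊢
            omega
          · rw [tog_of_ge _ _ _ _ _ (by omega), tog_of_ge _ _ _ _ _ (by omega)]
            exact hα.anti x _
      · omega
    · rw [tog_of_ne _ _ _ _ _ hy, tog_of_ne _ _ _ _ _ hy]
      exact hα.anti x y
  · have b1 := hbd x
    by_cases hy : y = i + 1
    · subst hy
      rw [tog_of_ne _ _ _ _ (i + 1 + 1) (by omega)]
      exact b1.2.2.1
    · rw [tog_of_ne _ _ _ _ _ hy]
      by_cases hy2 : y = i
      · subst hy2; exact b1.1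
      · rw [tog_of_ne _ _ _ _ _ (by omega)]
        exact hα.mono x y
  · have b1 := hbd x
    by_cases hy : y = i + 1
    · subst hy
      rw [tog_of_ne _ _ _ _ (i + 1 + 1) (by omega)]
      exact b1.2.2.2
    · rw [tog_of_ne _ _ _ _ _ hy]
      by_cases hy2 : y = i
      · subst hy2; exact b1.2.1
      · rw [tog_of_ne _ _ _ _ _ (by omega)]
        exact hα.step x y

theorem tog_tog (hα : Arr α) (i c : ℕ) : tog (tog α i c) i c = α := by
  funext x y
  by_cases hy : y = i + 1
  · subst hy
    by_cases hx : x < c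
    · have hgg : (fun x => tog α i c x i + tog α i c x (i + 2)) = (fun x => α x i + α x (i + 2)) := by
        funext x
        rw [tog_of_ne _ _ _ _ _ (by omega), tog_of_ne _ _ _ _ _ (by omega)]
      rw [tog_at _ _ _ _ hx, hgg, tog_at _ _ _ _ (rho_lt (gsum_anti hα i) c x hx),
        rho_rho (gsum_anti hα i) c x hx, tog_of_ne _ _ _ _ _ (by omega), tog_of_ne _ _ _ _ _ (by omega),
        (rho_vals hα i c x hx).1, (rho_vals hα i c x hx).2]
      have := hα.mono x i
      have := hα.mono2 x i
      have := hα.step x i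
      have := hα.step2 x i
      omega
    · rw [tog_of_ge _ _ _ _ _ (by omega), tog_of_ge _ _ _ _ _ (by omega)]
  · rw [tog_of_ne _ _ _ _ _ hy, tog_of_ne _ _ _ _ _ hy]

theorem tog_sum (hα : Arr α) (i c : ℕ) : ∑ x ∈ range c, tog α i c x (i + 1) + ∑ x ∈ range c, α x (i + 1) =
    ∑ x ∈ range c, α x i + ∑ x ∈ range c, α x (i + 2) := by
  have h1 : ∑ x ∈ range c, α x (i + 1) = ∑ x ∈ range c, α (rho (fun x => α x i + α x (i + 2)) c x) (i + 1) := by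
    refine Finset.sum_bij' (fun x _ => rho (fun x => α x i + α x (i + 2)) c x)
      (fun x _ => rho (fun x => α x i + α x (i + 2)) c x) ?_ ?_ ?_ ?_ ?_
    · intro x hx; rw [mem_range] at *; exact rho_lt (gsum_anti hα i) c x hx
    · intro x hx; rw [mem_range] at *; exact rho_lt (gsum_anti hα i) c x hx
    · intro x hx; rw [mem_range] at *; exact rho_rho (gsum_anti hα i) c x hx
    · intro x hx; rw [mem_range] at *; exact rho_rho (gsum_anti hα i) c x hx
    · intro x hx; rw [mem_range] at *
      rw [rho_rho (gsum_anti hα i) c x hx]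
  rw [h1, ← Finset.sum_add_distrib, ← Finset.sum_add_distrib]
  apply Finset.sum_congr rfl
  intro x hx
  rw [mem_range] at hx
  rw [tog_at _ _ _ _ hx]
  obtain ⟨h1, h2⟩ := rho_vals hα i c x hx
  have := hα.mono (rho (fun x => α x i + α x (i + 2)) c x) i
  have := hα.mono2 (rho (fun x => α x i + α x (i + 2)) c x) i
  have := hα.step (rho (fun x => α x i + α x (i + 2)) c x) i
  have := hα.step2 (rho (fun x => α x i + α x (i + 2)) c x) i
  omega

end


def inc (α : ℕ → ℕ → ℕ) (x y : ℕ) : ℕ := α x (y + 1) - α x y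
def xw (α β : ℕ → ℕ → ℕ) (j i : ℕ) : ℕ := if α j i ≤ β j i then inc α j i else inc β j i
def tw (α β : ℕ → ℕ → ℕ) (j i : ℕ) : ℕ := inc α j i + inc β j i
def Rr (C : ℕ) (α β : ℕ → ℕ → ℕ) (j i : ℕ) : ℕ := ∑ x ∈ Ico (j + 1) C, tw α β x i
def VX (C : ℕ) (α β : ℕ → ℕ → ℕ) (j i : ℕ) : Prop :=
  Rr C α β j i + xw α β j i < Rr C α β j (i + 1) + xw α β j (i + 1)
def VY (C : ℕ) (α β : ℕ → ℕ → ℕ) (j i : ℕ) : Prop :=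
  Rr C α β j i + tw α β j i < Rr C α β j (i + 1) + tw α β j (i + 1)
def Yam (N C : ℕ) (α β : ℕ → ℕ → ℕ) : Prop :=
  ∀ j < C, ∀ i, i + 1 < N → ¬ VX C α β j i ∧ ¬ VY C α β j i

def NoV (N C : ℕ) (α β : ℕ → ℕ → ℕ) (j : ℕ) : Prop :=
  ∀ j', j < j' → j' < C → ∀ i, i + 1 < N → ¬ VX C α β j' i ∧ ¬ VY C α β j' i

structure FDX (N C : ℕ) (α β : ℕ → ℕ → ℕ) (j i : ℕ) : Prop where
  hj : j < C
  hi : i + 1 < N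
  nov : NoV N C α β j
  vio : VX C α β j i
  min : ∀ i' < i, ¬ VX C α β j i'

structure FDY (N C : ℕ) (α β : ℕ → ℕ → ℕ) (j i : ℕ) : Prop where
  hj : j < C
  hi : i + 1 < N
  nov : NoV N C α β j
  nox : ∀ i', i' + 1 < N → ¬ VX C α β j i'
  vio : VY C α β j i
  min : ∀ i' < i, ¬ VY C α β j i'

theorem FD_exists (N C : ℕ) (α β : ℕ → ℕ → ℕ) (h : ¬ Yam N C α β) :
    ∃ j i, FDX N C α β j i ∨ FDY N C α β j i := by
  classical
  have hex : ∃ j, j < C ∧ ∃ i, i + 1 < N ∧ (VX C α β j i ∨ VY C α β j i) := by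
    by_contra hc
    apply h
    intro j hj i hi
    constructor
    · intro hv; exact hc ⟨j, hj, i, hi, Or.inl hv⟩
    · intro hv; exact hc ⟨j, hj, i, hi, Or.inr hv⟩
  -- maximal j
  have hmax : ∃ j, (j < C ∧ ∃ i, i + 1 < N ∧ (VX C α β j i ∨ VY C α β j i)) ∧ NoV N C α β j := by
    obtain ⟨j0, h0⟩ := hex
    let P : ℕ → Prop := fun j => j < C ∧ ∃ i, i + 1 < N ∧ (VX C α β j i ∨ VY C α β j i)
    refine ⟨Nat.findGreatest P C, Nat.findGreatest_spec (P := P) h0.1.le h0, ?_⟩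
    intro j' hj' hC i hi
    have := Nat.findGreatest_is_greatest hj' hC.le
    constructor
    · intro hv; exact this ⟨hC, i, hi, Or.inl hv⟩
    · intro hv; exact this ⟨hC, i, hi, Or.inr hv⟩
  obtain ⟨j, ⟨hj, i0, hi0, hv⟩, hn⟩ := hmax
  by_cases hX : ∃ i, i + 1 < N ∧ VX C α β j i
  · refine ⟨j, Nat.find hX, Or.inl ⟨hj, (Nat.find_spec hX).1, hn, (Nat.find_spec hX).2, ?_⟩⟩
    intro i' hi' hv'
    have := (Nat.find_spec hX).1
    exact Nat.find_min hX hi' ⟨by omega, hv'⟩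
  · have hX' : ∀ i', i' + 1 < N → ¬ VX C α β j i' := fun i' h1 h2 => hX ⟨i', h1, h2⟩
    have hY : ∃ i, i + 1 < N ∧ VY C α β j i := ⟨i0, hi0, hv.resolve_left (hX' i0 hi0)⟩
    refine ⟨j, Nat.find hY, Or.inr ⟨hj, (Nat.find_spec hY).1, hn, hX', (Nat.find_spec hY).2, ?_⟩⟩
    intro i' hi' hv'
    have := (Nat.find_spec hY).1
    exact Nat.find_min hY hi' ⟨by omega, hv'⟩

theorem FDX_unique {N C : ℕ} {α β : ℕ → ℕ → ℕ} {j i j' i' : ℕ} (h : FDX N C α β j i) (h' : FDX N C α β j' i') :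
    j = j' ∧ i = i' := by
  have hj : j = j' := by
    rcases lt_trichotomy j j' with h1 | h1 | h1
    · exact absurd h'.vio (h.nov j' h1 h'.hj i' h'.hi).1
    · exact h1
    · exact absurd h.vio (h'.nov j h1 h.hj i h.hi).1
  subst hj
  refine ⟨rfl, ?_⟩
  rcases lt_trichotomy i i' with h1 | h1 | h1
  · exact absurd h.vio (h'.min i h1)
  · exact h1
  · exact absurd h'.vio (h.min i' h1)

theorem FDY_unique {N C : ℕ} {α β : ℕ → ℕ → ℕ} {j i j' i' : ℕ} (h : FDY N C α β j i) (h' : FDY N C α β j' i') :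
    j = j' ∧ i = i' := by
  have hj : j = j' := by
    rcases lt_trichotomy j j' with h1 | h1 | h1
    · exact absurd h'.vio (h.nov j' h1 h'.hj i' h'.hi).2
    · exact h1
    · exact absurd h.vio (h'.nov j h1 h.hj i h.hi).2
  subst hj
  refine ⟨rfl, ?_⟩
  rcases lt_trichotomy i i' with h1 | h1 | h1
  · exact absurd h.vio (h'.min i h1)
  · exact h1
  · exact absurd h'.vio (h.min i' h1)

theorem FDXY_absurd {N C : ℕ} {α β : ℕ → ℕ → ℕ} {j i j' i' : ℕ} (h : FDX N C α β j i) (h' : FDY N C α β j' i') :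
    False := by
  rcases lt_trichotomy j j' with h1 | h1 | h1
  · exact absurd h'.vio (h.nov j' h1 h'.hj i' h'.hi).2
  · subst h1; exact h'.nox i h.hi h.vio
  · exact absurd h.vio (h'.nov j h1 h.hj i h.hi).1

theorem Rr_succ (C : ℕ) (α β : ℕ → ℕ → ℕ) (j i : ℕ) (h : j + 1 < C) :
    Rr C α β j i = tw α β (j + 1) i + Rr C α β (j + 1) i := by
  unfold Rr
  rw [Finset.sum_eq_sum_Ico_succ_bot h]

theorem Rr_le {N C : ℕ} {α β : ℕ → ℕ → ℕ} {j : ℕ} (h : NoV N C α β j) (i : ℕ) (hi : i + 1 < N) :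
    Rr C α β j (i + 1) ≤ Rr C α β j i := by
  by_cases hj : j + 1 < C
  · have := (h (j + 1) (by omega) hj i hi).2
    unfold VY at this
    rw [Rr_succ C α β j _ hj, Rr_succ C α β j _ hj]
    omega
  · unfold Rr
    rw [Finset.Ico_eq_empty (by omega)]
    simp

theorem inc_le_one {α : ℕ → ℕ → ℕ} (h : Arr α) (x y : ℕ) : inc α x y ≤ 1 := by
  have := h.step x y
  unfold inc; omega

theorem xw_le_one {α β : ℕ → ℕ → ℕ} (h : Arr α) (h' : Arr β) (x y : ℕ) : xw α β x y ≤ 1 := by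
  unfold xw
  split_ifs
  · exact inc_le_one h x y
  · exact inc_le_one h' x y

theorem xw_tw {α β : ℕ → ℕ → ℕ} (h : Arr α) (h' : Arr β) (x y : ℕ) :
    xw α β x y ≤ tw α β x y ∧ tw α β x y ≤ xw α β x y + 1 := by
  have := inc_le_one h x y
  have := inc_le_one h' x y
  unfold xw tw
  split_ifs <;> omega

theorem inc_eq {α : ℕ → ℕ → ℕ} (h : Arr α) (x y : ℕ) : α x (y + 1) = α x y + inc α x y := by
  have := h.mono x y
  unfold inc; omega

theorem inc_eq2 {α : ℕ → ℕ → ℕ} (h : Arr α) (x y : ℕ) : α x (y + 2) = α x (y + 1) + inc α x (y + 1) :=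
  inc_eq h x (y + 1)

section
variable {N C : ℕ} {α β : ℕ → ℕ → ℕ}

theorem FDX_facts (hα : Arr α) (hβ : Arr β) {j i : ℕ} (h : FDX N C α β j i) : Rr C α β j (i + 1) = Rr C α β j i ∧ xw α β j i = 0 ∧
    xw α β j (i + 1) = 1 := by
  have h1 := Rr_le h.nov i h.hi
  have h2 := h.vio
  have h3 := xw_le_one hα hβ j (i + 1)
  unfold VX at h2
  omega

theorem FDY_facts (hα : Arr α) (hβ : Arr β) {j i : ℕ} (h : FDY N C α β j i) : tw α β j i < tw α β j (i + 1) ∧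
    Rr C α β j (i + 1) + tw α β j (i + 1) = Rr C α β j i + tw α β j i + 1 := by
  have h1 := Rr_le h.nov i h.hi
  have h2 := h.vio
  have h3 := h.nox i h.hi
  have h4 := xw_tw hα hβ j i
  have h5 := xw_tw hα hβ j (i + 1)
  unfold VY at h2
  unfold VX at h3
  omega

theorem glueY (hα : Arr α) (hβ : Arr β) {j i : ℕ} (h : FDY N C α β j i) :
    (∀ x, x + 1 = j → ¬ (α x i = α (x + 1) i ∧
    α (x + 1) (i + 1) = α (x + 1) i + 1 ∧ α (x + 1) (i + 2) = α (x + 1) i + 1)) ∧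
    (∀ x, x + 1 = j → ¬ (β x i = β (x + 1) i ∧
    β (x + 1) (i + 1) = β (x + 1) i + 1 ∧ β (x + 1) (i + 2) = β (x + 1) i + 1)) := by
  have h1 := (FDY_facts hα hβ h).1
  have a1 := inc_eq hα j i
  have a2 := inc_eq2 hα j i
  have b1 := inc_eq hβ j i
  have b2 := inc_eq2 hβ j i
  have a3 := inc_le_one hα j (i + 1)
  have b3 := inc_le_one hβ j (i + 1)
  unfold tw at h1
  constructor
  · intro x hx
    rw [hx]
    rintro ⟨-, h2, h3⟩
    omega
  · intro x hx
    rw [hx]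
    rintro ⟨-, h2, h3⟩
    omega

theorem glueXlow (hα : Arr α) (hβ : Arr β) (zβ : ∀ x y, C ≤ x → β x y = 0) {j i : ℕ} (h : FDX N C α β j i) (hlow : α j i ≤ β j i) :
    (∀ x, x + 1 = j → ¬ (α x i = α (x + 1) i ∧
    α (x + 1) (i + 1) = α (x + 1) i + 1 ∧ α (x + 1) (i + 2) = α (x + 1) i + 1)) ∧
    (∀ x, x + 1 = j + 1 → ¬ (β x i = β (x + 1) i ∧
    β (x + 1) (i + 1) = β (x + 1) i + 1 ∧ β (x + 1) (i + 2) = β (x + 1) i + 1)) := by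
  obtain ⟨f1, f2, f3⟩ := FDX_facts hα hβ h
  have a1 := inc_eq hα j i
  have a2 := inc_eq2 hα j i
  have b1 := inc_eq hβ j i
  unfold xw at f2 f3
  rw [if_pos hlow] at f2
  rw [if_pos (by omega)] at f3
  constructor
  · intro x hx
    rw [hx]
    rintro ⟨-, h2, h3⟩
    omega
  · intro x hx
    have : x = j := by omega
    subst this
    rintro ⟨h1, h2, h3⟩
    by_cases hC : x + 1 < C
    · have n1 := (h.nov (x + 1) (by omega) hC i h.hi).1
      have n2 : NoV N C α β (x + 1) := fun j' hj' => h.nov j' (by omega)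
      have n3 := Rr_le n2 i h.hi
      rw [Rr_succ C α β x _ hC, Rr_succ C α β x _ hC] at f1
      have c1 := inc_eq hα (x + 1) i
      have c2 := inc_eq2 hα (x + 1) i
      have c3 := inc_eq hβ (x + 1) i
      have c4 := inc_eq2 hβ (x + 1) i
      have c5 := inc_le_one hα (x + 1) (i + 1)
      have c6 := hα.anti x i
      unfold tw at f1
      unfold VX xw at n1
      split_ifs at n1 <;> omega
    · have := zβ (x + 1) (i + 1) (by omega)
      omega

theorem glueXhigh (hα : Arr α) (hβ : Arr β) (zα : ∀ x y, C ≤ x → α x y = 0) {j i : ℕ} (h : FDX N C α β j i) (hlow : ¬ α j i ≤ β j i) :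
    (∀ x, x + 1 = j + 1 → ¬ (α x i = α (x + 1) i ∧
    α (x + 1) (i + 1) = α (x + 1) i + 1 ∧ α (x + 1) (i + 2) = α (x + 1) i + 1)) ∧
    (∀ x, x + 1 = j → ¬ (β x i = β (x + 1) i ∧
    β (x + 1) (i + 1) = β (x + 1) i + 1 ∧ β (x + 1) (i + 2) = β (x + 1) i + 1)) := by
  obtain ⟨f1, f2, f3⟩ := FDX_facts hα hβ h
  have a1 := inc_eq hα j i
  have b2 := inc_eq2 hβ j i
  have b1 := inc_eq hβ j i
  unfold xw at f2 f3
  rw [if_neg hlow] at f2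
  rw [if_neg (by omega)] at f3
  constructor
  · intro x hx
    have : x = j := by omega
    subst this
    rintro ⟨h1, h2, h3⟩
    by_cases hC : x + 1 < C
    · have n1 := (h.nov (x + 1) (by omega) hC i h.hi).1
      have n2 : NoV N C α β (x + 1) := fun j' hj' => h.nov j' (by omega)
      have n3 := Rr_le n2 i h.hi
      rw [Rr_succ C α β x _ hC, Rr_succ C α β x _ hC] at f1
      have c1 := inc_eq hα (x + 1) i
      have c2 := inc_eq2 hα (x + 1) i
      have c3 := inc_eq hβ (x + 1) i
      have c4 := inc_eq2 hβ (x + 1) i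
      have c5 := inc_le_one hβ (x + 1) (i + 1)
      have c6 := hβ.anti x i
      unfold tw at f1
      unfold VX xw at n1
      split_ifs at n1 <;> omega
    · have := zα (x + 1) (i + 1) (by omega)
      omega
  · intro x hx
    rw [hx]
    rintro ⟨-, h2, h3⟩
    omega

end


theorem Rr_congr {C : ℕ} {α β α' β' : ℕ → ℕ → ℕ} {j : ℕ} (h1 : ∀ x y, j < x → α' x y = α x y)
    (h2 : ∀ x y, j < x → β' x y = β x y) (j' i : ℕ) (hj : j ≤ j') : Rr C α' β' j' i = Rr C α β j' i := by
  unfold Rr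
  apply Finset.sum_congr rfl
  intro x hx
  rw [mem_Ico] at hx
  unfold tw inc
  rw [h1 x _ (by omega), h1 x _ (by omega), h2 x _ (by omega), h2 x _ (by omega)]

theorem V_congr {C : ℕ} {α β α' β' : ℕ → ℕ → ℕ} {j : ℕ} (h1 : ∀ x y, j < x → α' x y = α x y)
    (h2 : ∀ x y, j < x → β' x y = β x y) (j' i : ℕ) (hj : j ≤ j') (e1 : ∀ y, α' j' y = α j' y)
    (e2 : ∀ y, β' j' y = β j' y) :
    (VX C α' β' j' i ↔ VX C α β j' i) ∧ (VY C α' β' j' i ↔ VY C α β j' i) := by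
  unfold VX VY
  rw [Rr_congr h1 h2 j' i hj, Rr_congr h1 h2 j' (i + 1) hj]
  unfold xw tw inc
  simp only [e1, e2]
  simp

theorem NoV_congr {N C : ℕ} {α β α' β' : ℕ → ℕ → ℕ} {j : ℕ} (h1 : ∀ x y, j < x → α' x y = α x y)
    (h2 : ∀ x y, j < x → β' x y = β x y) (h : NoV N C α β j) : NoV N C α' β' j := by
  intro j' hj' hC i hi
  have := V_congr (C := C) h1 h2 j' i hj'.le (fun y => h1 j' y hj') (fun y => h2 j' y hj')
  rw [this.1, this.2]
  exact h j' hj' hC i hi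

theorem FDY_inv {N C : ℕ} {α β : ℕ → ℕ → ℕ} {j i : ℕ} (h : FDY N C α β j i) :
    FDY N C (tog α i j) (tog β i j) j i := by
  have h1 : ∀ x y, j < x → tog α i j x y = α x y := fun x y hx => tog_of_ge _ _ _ _ _ hx.le
  have h2 : ∀ x y, j < x → tog β i j x y = β x y := fun x y hx => tog_of_ge _ _ _ _ _ hx.le
  have hv := fun i' => V_congr (C := C) h1 h2 j i' le_rfl (fun y => tog_of_ge _ _ _ _ _ le_rfl)
    (fun y => tog_of_ge _ _ _ _ _ le_rfl)
  exact ⟨h.hj, h.hi, NoV_congr h1 h2 h.nov, fun i' hi' => (hv i').1.not.2 (h.nox i' hi'),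
    (hv i).2.2 h.vio, fun i' hi' => (hv i').2.not.2 (h.min i' hi')⟩

theorem FDX_inv_aux {N C : ℕ} {α β α' β' : ℕ → ℕ → ℕ} {j i : ℕ} (h : FDX N C α β j i)
    (h1 : ∀ x y, j < x → α' x y = α x y) (h2 : ∀ x y, j < x → β' x y = β x y)
    (hx : ∀ i', i' ≤ i + 1 → xw α' β' j i' = xw α β j i') : FDX N C α' β' j i := by
  have hv : ∀ i', i' ≤ i → (VX C α' β' j i' ↔ VX C α β j i') := by
    intro i' hi'
    unfold VX
    rw [Rr_congr h1 h2 j _ le_rfl, Rr_congr h1 h2 j _ le_rfl, hx i' (by omega), hx (i' + 1) (by omega)]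
  exact ⟨h.hj, h.hi, NoV_congr h1 h2 h.nov, (hv i le_rfl).2 h.vio, fun i' hi' => (hv i' hi'.le).not.2 (h.min i' hi')⟩

section
variable {N C : ℕ} {α β : ℕ → ℕ → ℕ}

theorem FDX_inv_low (hα : Arr α) (hβ : Arr β) {j i : ℕ} (h : FDX N C α β j i) (hlow : α j i ≤ β j i) :
    FDX N C (tog α i j) (tog β i (j + 1)) j i := by
  obtain ⟨f1, f2, f3⟩ := FDX_facts hα hβ h
  apply FDX_inv_aux h
  · exact fun x y hx => tog_of_ge _ _ _ _ _ hx.le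
  · exact fun x y hx => tog_of_ge _ _ _ _ _ hx
  · intro i' hi'
    have ea : ∀ y, tog α i j j y = α j y := fun y => tog_of_ge _ _ _ _ _ le_rfl
    have eb : ∀ y, y ≠ i + 1 → tog β i (j + 1) j y = β j y := fun y hy => tog_of_ne _ _ _ _ _ hy
    by_cases hi1 : i' = i + 1
    · subst hi1
      have a1 := inc_eq hα j i
      have b1 := hβ.mono j i
      have tb := tog_bounds hβ i (j + 1) j (by omega)
      have : inc α j i = 0 := by
        unfold xw at f2
        rwa [if_pos hlow] at f2
      unfold xw inc
      rw [ea, ea, if_pos (by omega), if_pos (by omega)]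
    · by_cases hi2 : i' = i
      · subst hi2
        unfold xw inc
        rw [ea, ea, eb _ (by omega), if_pos hlow, if_pos hlow]
      · unfold xw inc
        rw [ea, ea, eb _ (by omega), eb _ (by omega)]

theorem FDX_inv_high (hα : Arr α) (hβ : Arr β) {j i : ℕ} (h : FDX N C α β j i) (hlow : ¬ α j i ≤ β j i) :
    FDX N C (tog α i (j + 1)) (tog β i j) j i := by
  obtain ⟨f1, f2, f3⟩ := FDX_facts hα hβ h
  apply FDX_inv_aux h
  · exact fun x y hx => tog_of_ge _ _ _ _ _ hx
  · exact fun x y hx => tog_of_ge _ _ _ _ _ hx.le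
  · intro i' hi'
    have ea : ∀ y, tog β i j j y = β j y := fun y => tog_of_ge _ _ _ _ _ le_rfl
    have eb : ∀ y, y ≠ i + 1 → tog α i (j + 1) j y = α j y := fun y hy => tog_of_ne _ _ _ _ _ hy
    by_cases hi1 : i' = i + 1
    · subst hi1
      have a1 := inc_eq hβ j i
      have b1 := hα.mono j i
      have tb := tog_bounds hα i (j + 1) j (by omega)
      have : inc β j i = 0 := by
        unfold xw at f2
        rwa [if_neg hlow] at f2
      unfold xw inc
      rw [ea, ea, if_neg (by omega), if_neg (by omega)]
    · by_cases hi2 : i' = i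
      · subst hi2
        unfold xw inc
        rw [ea, ea, eb _ (by omega), if_neg hlow, if_neg hlow]
      · unfold xw inc
        rw [ea, ea, eb _ (by omega), eb _ (by omega)]

end

theorem sum_inc {α : ℕ → ℕ → ℕ} (hα : Arr α) (c y : ℕ) :
    ∑ x ∈ range c, α x y + ∑ x ∈ range c, inc α x y = ∑ x ∈ range c, α x (y + 1) := by
  rw [← Finset.sum_add_distrib]
  exact Finset.sum_congr rfl fun x _ => (inc_eq hα x y).symm

theorem tinc_split (α : ℕ → ℕ → ℕ) (C c y : ℕ) (hc : c ≤ C) :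
    tinc C α y = ∑ x ∈ range c, inc α x y + ∑ x ∈ Ico c C, inc α x y := by
  unfold tinc
  rw [← Finset.sum_range_add_sum_Ico _ hc]
  rfl

theorem tinc_tog {α : ℕ → ℕ → ℕ} (hα : Arr α) (C c i : ℕ) (hc : c ≤ C) (ht : Arr (tog α i c)) :
    tinc C (tog α i c) i = ∑ x ∈ range c, inc α x (i + 1) + ∑ x ∈ Ico c C, inc α x i ∧
    tinc C (tog α i c) (i + 1) = ∑ x ∈ range c, inc α x i + ∑ x ∈ Ico c C, inc α x (i + 1) := by
  have hI : ∀ y, ∑ x ∈ Ico c C, inc (tog α i c) x y = ∑ x ∈ Ico c C, inc α x y := by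
    intro y
    apply Finset.sum_congr rfl
    intro x hx
    rw [mem_Ico] at hx
    unfold inc
    rw [tog_of_ge _ _ _ _ _ hx.1, tog_of_ge _ _ _ _ _ hx.1]
  have s0 := tog_sum hα i c
  have s1 := sum_inc hα c i
  have s2 := sum_inc hα c (i + 1)
  have s3 := sum_inc ht c i
  have s4 := sum_inc ht c (i + 1)
  have e1 : ∑ x ∈ range c, tog α i c x i = ∑ x ∈ range c, α x i :=
    Finset.sum_congr rfl fun x _ => tog_of_ne _ _ _ _ _ (by omega)
  have e2 : ∑ x ∈ range c, tog α i c x (i + 1 + 1) = ∑ x ∈ range c, α x (i + 1 + 1) :=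
    Finset.sum_congr rfl fun x _ => tog_of_ne _ _ _ _ _ (by omega)
  have e3 : ∑ x ∈ range c, α x (i + 2) = ∑ x ∈ range c, α x (i + 1 + 1) := rfl
  rw [tinc_split _ _ _ _ hc, tinc_split _ _ _ _ hc, hI, hI]
  omega

theorem tinc_tog_ne (α : ℕ → ℕ → ℕ) (C c i y : ℕ) (h1 : y ≠ i) (h2 : y ≠ i + 1) :
    tinc C (tog α i c) y = tinc C α y := by
  unfold tinc
  apply Finset.sum_congr rfl
  intro x _
  rw [tog_of_ne _ _ _ _ _ h2, tog_of_ne _ _ _ _ _ (by omega)]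

def wtp (C : ℕ) (o : (ℕ → ℕ → ℕ) × (ℕ → ℕ → ℕ)) (y : ℕ) : ℕ := tinc C o.1 y + tinc C o.2 y

def opX (j i : ℕ) (o : (ℕ → ℕ → ℕ) × (ℕ → ℕ → ℕ)) : (ℕ → ℕ → ℕ) × (ℕ → ℕ → ℕ) :=
  if o.1 j i ≤ o.2 j i then (tog o.1 i j, tog o.2 i (j + 1)) else (tog o.1 i (j + 1), tog o.2 i j)

def opY (j i : ℕ) (o : (ℕ → ℕ → ℕ) × (ℕ → ℕ → ℕ)) : (ℕ → ℕ → ℕ) × (ℕ → ℕ → ℕ) :=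
  (tog o.1 i j, tog o.2 i j)

open Classical in
noncomputable def invo (N C : ℕ) (o : (ℕ → ℕ → ℕ) × (ℕ → ℕ → ℕ)) : (ℕ → ℕ → ℕ) × (ℕ → ℕ → ℕ) :=
  if h : ∃ p : ℕ × ℕ, FDX N C o.1 o.2 p.1 p.2 then opX h.choose.1 h.choose.2 o
  else if h : ∃ p : ℕ × ℕ, FDY N C o.1 o.2 p.1 p.2 then opY h.choose.1 h.choose.2 o
  else o

theorem invo_X {N C : ℕ} {o : (ℕ → ℕ → ℕ) × (ℕ → ℕ → ℕ)} {j i : ℕ} (h : FDX N C o.1 o.2 j i) :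
    invo N C o = opX j i o := by
  have hex : ∃ p : ℕ × ℕ, FDX N C o.1 o.2 p.1 p.2 := ⟨(j, i), h⟩
  have := FDX_unique h hex.choose_spec
  unfold invo
  rw [dif_pos hex, ← this.1, ← this.2]

theorem invo_Y {N C : ℕ} {o : (ℕ → ℕ → ℕ) × (ℕ → ℕ → ℕ)} {j i : ℕ} (h : FDY N C o.1 o.2 j i) :
    invo N C o = opY j i o := by
  have hex : ∃ p : ℕ × ℕ, FDY N C o.1 o.2 p.1 p.2 := ⟨(j, i), h⟩
  have hex2 : ¬ ∃ p : ℕ × ℕ, FDX N C o.1 o.2 p.1 p.2 := fun ⟨p, hp⟩ => FDXY_absurd hp h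
  have := FDY_unique h hex.choose_spec
  unfold invo
  rw [dif_neg hex2, dif_pos hex, ← this.1, ← this.2]

theorem opX_opX {o : (ℕ → ℕ → ℕ) × (ℕ → ℕ → ℕ)} (h1 : Arr o.1) (h2 : Arr o.2) (j i : ℕ) :
    opX j i (opX j i o) = o := by
  by_cases hl : o.1 j i ≤ o.2 j i
  · have e : opX j i o = (tog o.1 i j, tog o.2 i (j + 1)) := by unfold opX; rw [if_pos hl]
    rw [e]
    unfold opX
    have hc : tog o.1 i j j i ≤ tog o.2 i (j + 1) j i := by
      rw [tog_of_ne _ _ _ _ _ (by omega), tog_of_ne _ _ _ _ _ (by omega)]; exact hl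
    rw [if_pos hc, tog_tog h1, tog_tog h2]
  · have e : opX j i o = (tog o.1 i (j + 1), tog o.2 i j) := by unfold opX; rw [if_neg hl]
    rw [e]
    unfold opX
    have hc : ¬ tog o.1 i (j + 1) j i ≤ tog o.2 i j j i := by
      rw [tog_of_ne _ _ _ _ _ (by omega), tog_of_ne _ _ _ _ _ (by omega)]; exact hl
    rw [if_neg hc, tog_tog h1, tog_tog h2]

/-- all facts about the involution -/
theorem invo_spec {N C : ℕ} {o : (ℕ → ℕ → ℕ) × (ℕ → ℕ → ℕ)} (h1 : Arr o.1) (h2 : Arr o.2)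
    (z1 : ∀ x y, C ≤ x → o.1 x y = 0) (z2 : ∀ x y, C ≤ x → o.2 x y = 0) (hY : ¬ Yam N C o.1 o.2) :
    Arr (invo N C o).1 ∧ Arr (invo N C o).2 ∧ ¬ Yam N C (invo N C o).1 (invo N C o).2 ∧
    invo N C (invo N C o) = o ∧
    (∃ i, i + 1 < N ∧ (∀ x y, y ≠ i + 1 → (invo N C o).1 x y = o.1 x y ∧ (invo N C o).2 x y = o.2 x y) ∧
      wtp C (invo N C o) i + 1 = wtp C o (i + 1) ∧ wtp C (invo N C o) (i + 1) = wtp C o i + 1 ∧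
      ∀ y, y ≠ i → y ≠ i + 1 → wtp C (invo N C o) y = wtp C o y) := by
  obtain ⟨j, i, hX | hYY⟩ := FD_exists N C o.1 o.2 hY
  · rw [invo_X hX]
    obtain ⟨f1, f2, f3⟩ := FDX_facts h1 h2 hX
    have hj := hX.hj
    by_cases hl : o.1 j i ≤ o.2 j i
    · have e : opX j i o = (tog o.1 i j, tog o.2 i (j + 1)) := by unfold opX; rw [if_pos hl]
      have g := glueXlow h1 h2 z2 hX hl
      have t1 := tog_arr h1 i j g.1
      have t2 := tog_arr h2 i (j + 1) g.2
      have hX' : FDX N C (opX j i o).1 (opX j i o).2 j i := by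
        rw [e]; exact FDX_inv_low h1 h2 hX hl
      refine ⟨by rw [e]; exact t1, by rw [e]; exact t2, ?_, ?_, i, hX.hi, ?_, ?_⟩
      · intro hc; exact (hc j hX.hj i hX.hi).1 hX'.vio
      · rw [invo_X hX', opX_opX h1 h2]
      · intro x y hy
        rw [e]
        exact ⟨tog_of_ne _ _ _ _ _ hy, tog_of_ne _ _ _ _ _ hy⟩
      · rw [e]
        unfold wtp
        dsimp only
        refine ⟨?_, ?_, ?_⟩
        rotate_left 2
        · intro y hy1 hy2
          rw [tinc_tog_ne _ _ _ _ _ hy1 hy2, tinc_tog_ne _ _ _ _ _ hy1 hy2]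
        all_goals
          obtain ⟨w1, w2⟩ := tinc_tog h1 C j i hj.le t1
          obtain ⟨w3, w4⟩ := tinc_tog h2 C (j + 1) i hj t2
          have s1 := tinc_split o.1 C j i hj.le
          have s2 := tinc_split o.1 C j (i + 1) hj.le
          have s3 := tinc_split o.2 C (j + 1) i hj
          have s4 := tinc_split o.2 C (j + 1) (i + 1) hj
          have r1 := Finset.sum_eq_sum_Ico_succ_bot hj (fun x => inc o.1 x i)
          have r2 := Finset.sum_eq_sum_Ico_succ_bot hj (fun x => inc o.1 x (i + 1))
          unfold Rr tw at f1
          rw [Finset.sum_add_distrib, Finset.sum_add_distrib] at f1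
          have a1 := inc_eq h1 j i
          have b1 := inc_eq h2 j i
          unfold xw at f2 f3
          rw [if_pos hl] at f2
          rw [if_pos (by omega)] at f3
          omega
    · have e : opX j i o = (tog o.1 i (j + 1), tog o.2 i j) := by unfold opX; rw [if_neg hl]
      have g := glueXhigh h1 h2 z1 hX hl
      have t1 := tog_arr h1 i (j + 1) g.1
      have t2 := tog_arr h2 i j g.2
      have hX' : FDX N C (opX j i o).1 (opX j i o).2 j i := by
        rw [e]; exact FDX_inv_high h1 h2 hX hl
      refine ⟨by rw [e]; exact t1, by rw [e]; exact t2, ?_, ?_, i, hX.hi, ?_, ?_⟩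
      · intro hc; exact (hc j hX.hj i hX.hi).1 hX'.vio
      · rw [invo_X hX', opX_opX h1 h2]
      · intro x y hy
        rw [e]
        exact ⟨tog_of_ne _ _ _ _ _ hy, tog_of_ne _ _ _ _ _ hy⟩
      · rw [e]
        unfold wtp
        dsimp only
        refine ⟨?_, ?_, ?_⟩
        rotate_left 2
        · intro y hy1 hy2
          rw [tinc_tog_ne _ _ _ _ _ hy1 hy2, tinc_tog_ne _ _ _ _ _ hy1 hy2]
        all_goals
          obtain ⟨w1, w2⟩ := tinc_tog h2 C j i hj.le t2
          obtain ⟨w3, w4⟩ := tinc_tog h1 C (j + 1) i hj t1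
          have s1 := tinc_split o.2 C j i hj.le
          have s2 := tinc_split o.2 C j (i + 1) hj.le
          have s3 := tinc_split o.1 C (j + 1) i hj
          have s4 := tinc_split o.1 C (j + 1) (i + 1) hj
          have r1 := Finset.sum_eq_sum_Ico_succ_bot hj (fun x => inc o.2 x i)
          have r2 := Finset.sum_eq_sum_Ico_succ_bot hj (fun x => inc o.2 x (i + 1))
          unfold Rr tw at f1
          rw [Finset.sum_add_distrib, Finset.sum_add_distrib] at f1
          have a1 := inc_eq h1 j i
          have b1 := inc_eq h2 j i
          unfold xw at f2 f3
          rw [if_neg hl] at f2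
          rw [if_neg (by omega)] at f3
          omega
  · rw [invo_Y hYY]
    obtain ⟨f1, f2⟩ := FDY_facts h1 h2 hYY
    have hj := hYY.hj
    have g := glueY h1 h2 hYY
    have t1 := tog_arr h1 i j g.1
    have t2 := tog_arr h2 i j g.2
    have hY' : FDY N C (opY j i o).1 (opY j i o).2 j i := FDY_inv hYY
    refine ⟨t1, t2, ?_, ?_, i, hYY.hi, ?_, ?_⟩
    · intro hc; exact (hc j hYY.hj i hYY.hi).2 hY'.vio
    · rw [invo_Y hY']
      unfold opY
      rw [tog_tog h1, tog_tog h2]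
    · intro x y hy
      exact ⟨tog_of_ne _ _ _ _ _ hy, tog_of_ne _ _ _ _ _ hy⟩
    · unfold wtp opY
      dsimp only
      refine ⟨?_, ?_, ?_⟩
      rotate_left 2
      · intro y hy1 hy2
        rw [tinc_tog_ne _ _ _ _ _ hy1 hy2, tinc_tog_ne _ _ _ _ _ hy1 hy2]
      all_goals
        obtain ⟨w1, w2⟩ := tinc_tog h2 C j i hj.le t2
        obtain ⟨w3, w4⟩ := tinc_tog h1 C j i hj.le t1
        have s1 := tinc_split o.2 C j i hj.le
        have s2 := tinc_split o.2 C j (i + 1) hj.le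
        have s3 := tinc_split o.1 C j i hj.le
        have s4 := tinc_split o.1 C j (i + 1) hj.le
        have r1 := Finset.sum_eq_sum_Ico_succ_bot hj (fun x => inc o.2 x i)
        have r2 := Finset.sum_eq_sum_Ico_succ_bot hj (fun x => inc o.2 x (i + 1))
        have r3 := Finset.sum_eq_sum_Ico_succ_bot hj (fun x => inc o.1 x i)
        have r4 := Finset.sum_eq_sum_Ico_succ_bot hj (fun x => inc o.1 x (i + 1))
        unfold Rr tw at f2
        rw [Finset.sum_add_distrib, Finset.sum_add_distrib] at f2
        omega


theorem Tab.arr {N : ℕ} {m l : ℕ → ℕ} {α : ℕ → ℕ → ℕ} (h : Tab N m l α) : Arr α := ⟨h.anti, h.mono, h.step⟩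

noncomputable def wtn (N C : ℕ) (o : (ℕ → ℕ → ℕ) × (ℕ → ℕ → ℕ)) : ℕ → ℕ := fun y => if y < N then wtp C o y else 0

theorem Tab.zero {N C : ℕ} {m l : ℕ → ℕ} {α : ℕ → ℕ → ℕ} (h : Tab N m l α) (hC : ∀ x, C ≤ x → l x = 0) :
    ∀ x y, C ≤ x → α x y = 0 := by
  intro x y hx
  have := h.le_top x y
  rw [hC x hx] at this
  omega

theorem wtp_eq (C : ℕ) (o : (ℕ → ℕ → ℕ) × (ℕ → ℕ → ℕ)) (hC : 0 < C) (i : ℕ) :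
    wtp C o i = Rr C o.1 o.2 0 i + tw o.1 o.2 0 i := by
  have : wtp C o i = ∑ x ∈ range C, tw o.1 o.2 x i := by
    unfold wtp tinc tw inc
    rw [Finset.sum_add_distrib]
  rw [this, Finset.range_eq_Ico, Finset.sum_eq_sum_Ico_succ_bot hC, add_comm]
  rfl

theorem Yam_anti {N C : ℕ} {o : (ℕ → ℕ → ℕ) × (ℕ → ℕ → ℕ)} (h : Yam N C o.1 o.2) :
    Antitone (wtn N C o) := by
  apply antitone_nat_of_succ_le
  intro i
  unfold wtn
  by_cases hi : i + 1 < N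
  · rw [if_pos hi, if_pos (by omega)]
    rcases Nat.eq_zero_or_pos C with hC | hC
    · subst hC; simp [wtp, tinc]
    · rw [wtp_eq C o hC, wtp_eq C o hC]
      have := (h 0 hC i hi).2
      unfold VY at this
      omega
  · rw [if_neg hi]; omega

open Classical in
theorem cancel_sum (N C : ℕ) (m l r n : ℕ → ℕ) (hl : IsPart l) (hn : IsPart n)
    (hlC : ∀ x, C ≤ x → l x = 0) (hnC : ∀ x, C ≤ x → n x = 0) :
    ∑ o ∈ tabF N m l hl ×ˢ tabF N r n hn, alt N (fun y => wtp C o y + dlt N y) =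
    ∑ o ∈ (tabF N m l hl ×ˢ tabF N r n hn).filter (fun o => Yam N C o.1 o.2),
      alt N (fun y => wtp C o y + dlt N y) := by
  rw [← Finset.sum_filter_add_sum_filter_not _ (fun o => Yam N C o.1 o.2), add_eq_left]
  have key : ∀ o ∈ (tabF N m l hl ×ˢ tabF N r n hn).filter (fun o => ¬ Yam N C o.1 o.2),
      (invo N C o ∈ (tabF N m l hl ×ˢ tabF N r n hn).filter (fun o => ¬ Yam N C o.1 o.2)) ∧
      invo N C (invo N C o) = o ∧
      alt N (fun y => wtp C o y + dlt N y) + alt N (fun y => wtp C (invo N C o) y + dlt N y) = 0 := by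
    intro o ho
    rw [mem_filter, mem_product, mem_tabF, mem_tabF] at ho
    obtain ⟨⟨t1, t2⟩, hY⟩ := ho
    obtain ⟨a1, a2, nY, inv, i, hi, hne, w1, w2, w3⟩ := invo_spec t1.arr t2.arr (t1.zero hlC) (t2.zero hnC) hY
    refine ⟨?_, inv, ?_⟩
    · rw [mem_filter, mem_product, mem_tabF, mem_tabF]
      refine ⟨⟨⟨a1.anti, a1.mono, a1.step, fun x => ?_, fun x y hy => ?_⟩,
        ⟨a2.anti, a2.mono, a2.step, fun x => ?_, fun x y hy => ?_⟩⟩, nY⟩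
      · rw [(hne x 0 (by omega)).1, t1.bot]
      · rw [(hne x y (by omega)).1, t1.top x y hy]
      · rw [(hne x 0 (by omega)).2, t2.bot]
      · rw [(hne x y (by omega)).2, t2.top x y hy]
    · apply alt_swap N _ _ (⟨i, by omega⟩ : Fin N) ⟨i + 1, hi⟩ (by simp)
      intro y
      by_cases h1 : y = (⟨i, by omega⟩ : Fin N)
      · subst h1
        rw [Equiv.swap_apply_left]
        simp only [dlt]
        omega
      · by_cases h2 : y = (⟨i + 1, hi⟩ : Fin N)
        · subst h2
          rw [Equiv.swap_apply_right]
          simp only [dlt]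
          omega
        · rw [Equiv.swap_apply_of_ne_of_ne h1 h2]
          rw [w3 y (fun h => h1 (Fin.ext h)) (fun h => h2 (Fin.ext h))]
  refine Finset.sum_involution (fun o _ => invo N C o) (fun o ho => (key o ho).2.2) ?_
    (fun o ho => (key o ho).1) (fun o ho => (key o ho).2.1)
  intro o ho hne heq
  have := (key o ho).2.2
  rw [heq, ← two_mul] at this
  rcases mul_eq_zero.1 this with h | h
  · exact absurd h (by norm_num)
  · exact hne h

open Classical in
theorem LR (N k k' C : ℕ) (lam mu nu rho : ℕ → ℕ) (hl : IsPart lam) (hm : IsPart mu)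
    (hn : IsPart nu) (hr : IsPart rho)
    (hlk : ∀ i, k ≤ i → lam i = 0) (hmk : ∀ i, k ≤ i → mu i = 0)
    (hnk : ∀ i, k' ≤ i → nu i = 0) (hrk : ∀ i, k' ≤ i → rho i = 0)
    (hlC : ∀ i, lam i ≤ C) (hnC : ∀ i, nu i ≤ C) :
    skewSchur N k lam mu * skewSchur N k' nu rho =
    ∑ o ∈ (tabF N (conjPart mu) (conjPart lam) (isPart_conj hl) ×ˢ
        tabF N (conjPart rho) (conjPart nu) (isPart_conj hn)).filter (fun o => Yam N C o.1 o.2),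
      skewSchur N N (wtn N C o) (fun _ => 0) := by
  apply mul_left_cancel₀ (alt_dlt_ne N)
  have e1 := alt_mul_sum N (tabF N (conjPart mu) (conjPart lam) (isPart_conj hl) ×ˢ
        tabF N (conjPart rho) (conjPart nu) (isPart_conj hn)) (fun o y => wtp C o y)
        (skewSchur N k lam mu * skewSchur N k' nu rho) (by
          rw [skewSchur_tab N k C lam mu hl hm hlk hmk hlC, skewSchur_tab N k' C nu rho hn hr hnk hrk hnC,
            Finset.sum_product, Finset.sum_mul_sum]
          apply Finset.sum_congr rfl
          intro a _
          apply Finset.sum_congr rfl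
          intro b _
          rw [← Finset.prod_mul_distrib]
          apply Finset.prod_congr rfl
          intro y _
          rw [← pow_add]
          rfl) ((skewSchur_symm _ _ _ _).mul (skewSchur_symm _ _ _ _))
  rw [e1, cancel_sum N C _ _ _ _ _ _ (fun x hx => conj_zero_of_le hl hlC x hx)
    (fun x hx => conj_zero_of_le hn hnC x hx), Finset.mul_sum]
  apply Finset.sum_congr rfl
  intro o _
  rw [← alt_eq]
  congr 1
  funext y
  unfold wtn
  rw [if_pos y.2]


/-- Links between nodes, in terms of the pointwise minimum `a` and maximum `b`. -/
def Lk (a b : ℕ → ℕ → ℕ) (p q : ℕ × ℕ) : Prop :=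
  (q = (p.1, p.2 + 1) ∧ a p.1 p.2 < b p.1 p.2 ∧ a q.1 q.2 < b q.1 q.2) ∨
  (p = (q.1, q.2 + 1) ∧ a p.1 p.2 < b p.1 p.2 ∧ a q.1 q.2 < b q.1 q.2) ∨
  (q = (p.1 + 1, p.2) ∧ a p.1 p.2 < b q.1 q.2) ∨
  (p = (q.1 + 1, q.2) ∧ a q.1 q.2 < b p.1 p.2)

def mnn (α β : ℕ → ℕ → ℕ) (x y : ℕ) : ℕ := min (α x y) (β x y)
def mxx (α β : ℕ → ℕ → ℕ) (x y : ℕ) : ℕ := max (α x y) (β x y)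

def FF (N : ℕ) (α β : ℕ → ℕ → ℕ) (p : ℕ × ℕ) : Prop :=
  ∃ q : ℕ × ℕ, ((q.2 = 0 ∨ N ≤ q.2) ∧ α q.1 q.2 < β q.1 q.2) ∧
    Relation.ReflTransGen (Lk (mnn α β) (mxx α β)) q p

theorem Lk_lt {α β : ℕ → ℕ → ℕ} (hα : Arr α) (hβ : Arr β) {p q : ℕ × ℕ} (h : Lk (mnn α β) (mxx α β) p q)
    (hp : α p.1 p.2 < β p.1 p.2) : α q.1 q.2 < β q.1 q.2 := by
  obtain ⟨x, y⟩ := p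
  obtain ⟨x', y'⟩ := q
  unfold Lk mnn mxx at h
  simp only [Prod.mk.injEq] at h hp ⊢
  rcases h with ⟨⟨rfl, rfl⟩, h1, h2⟩ | ⟨⟨rfl, rfl⟩, h1, h2⟩ | ⟨⟨rfl, rfl⟩, h1⟩ | ⟨⟨rfl, rfl⟩, h1⟩
  · have a1 := hα.mono x' y
    have a2 := hα.step x' y
    have a3 := hβ.mono x' y
    have a4 := hβ.step x' y
    omega
  · have a1 := hα.mono x y'
    have a2 := hα.step x y'
    have a3 := hβ.mono x y'
    have a4 := hβ.step x y'
    omega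
  · have a1 := hα.anti x y'
    have a2 := hβ.anti x y'
    omega
  · have a1 := hα.anti x' y
    have a2 := hβ.anti x' y
    omega

theorem FF_lt {N : ℕ} {α β : ℕ → ℕ → ℕ} (hα : Arr α) (hβ : Arr β) {x y : ℕ} (h : FF N α β (x, y)) :
    α x y < β x y := by
  obtain ⟨q, ⟨_, hq⟩, hr⟩ := h
  have : ∀ p, Relation.ReflTransGen (Lk (mnn α β) (mxx α β)) q p → α p.1 p.2 < β p.1 p.2 := by
    intro p hp
    induction hp with
    | refl => exact hq
    | tail _ h2 ih => exact Lk_lt hα hβ h2 ih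
  exact this _ hr

theorem FF_step {N : ℕ} {α β : ℕ → ℕ → ℕ} {p q : ℕ × ℕ} (h : FF N α β p) (hl : Lk (mnn α β) (mxx α β) p q) :
    FF N α β q := by
  obtain ⟨r, hr, hp⟩ := h
  exact ⟨r, hr, hp.tail hl⟩

theorem FF_vert {N : ℕ} {α β : ℕ → ℕ → ℕ} {x y : ℕ} (h1 : α x y ≠ β x y) (h2 : α x (y + 1) ≠ β x (y + 1)) :
    FF N α β (x, y) ↔ FF N α β (x, y + 1) := by
  have e1 : mnn α β x y < mxx α β x y := by unfold mnn mxx; omega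
  have e2 : mnn α β x (y + 1) < mxx α β x (y + 1) := by unfold mnn mxx; omega
  constructor
  · intro h
    exact FF_step h (Or.inl ⟨rfl, e1, e2⟩)
  · intro h
    exact FF_step h (Or.inr (Or.inl ⟨rfl, e2, e1⟩))

theorem FF_horiz {N : ℕ} {α β : ℕ → ℕ → ℕ} {x y : ℕ} (h1 : min (α x y) (β x y) < max (α (x + 1) y) (β (x + 1) y)) :
    FF N α β (x, y) ↔ FF N α β (x + 1, y) := by
  constructor
  · intro h
    exact FF_step h (Or.inr (Or.inr (Or.inl ⟨rfl, h1⟩)))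
  · intro h
    exact FF_step h (Or.inr (Or.inr (Or.inr ⟨rfl, h1⟩)))

open Classical in
noncomputable def sw1 (N : ℕ) (α β : ℕ → ℕ → ℕ) (x y : ℕ) : ℕ := if FF N α β (x, y) then β x y else α x y
open Classical in
noncomputable def sw2 (N : ℕ) (α β : ℕ → ℕ → ℕ) (x y : ℕ) : ℕ := if FF N α β (x, y) then α x y else β x y

theorem sw_cases (N : ℕ) (α β : ℕ → ℕ → ℕ) (x y : ℕ) :
    (FF N α β (x, y) ∧ sw1 N α β x y = β x y ∧ sw2 N α β x y = α x y) ∨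
    (¬ FF N α β (x, y) ∧ sw1 N α β x y = α x y ∧ sw2 N α β x y = β x y) := by
  unfold sw1 sw2
  by_cases h : FF N α β (x, y)
  · left; simp [h]
  · right; simp [h]

section
variable {α β : ℕ → ℕ → ℕ}

theorem sw_arr (hα : Arr α) (hβ : Arr β) (N : ℕ) : Arr (sw1 N α β) ∧ Arr (sw2 N α β) := by
  have hh : ∀ x y, sw1 N α β (x + 1) y ≤ sw1 N α β x y ∧ sw2 N α β (x + 1) y ≤ sw2 N α β x y := by
    intro x y
    have a1 := hα.anti x y
    have a2 := hβ.anti x y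
    by_cases h : min (α x y) (β x y) < max (α (x + 1) y) (β (x + 1) y)
    · have := FF_horiz (N := N) h
      rcases sw_cases N α β x y with ⟨f, e1, e2⟩ | ⟨f, e1, e2⟩ <;>
      rcases sw_cases N α β (x + 1) y with ⟨f', e1', e2'⟩ | ⟨f', e1', e2'⟩ <;>
      first | (exfalso; tauto) | omega
    · rcases sw_cases N α β x y with ⟨f, e1, e2⟩ | ⟨f, e1, e2⟩ <;>
      rcases sw_cases N α β (x + 1) y with ⟨f', e1', e2'⟩ | ⟨f', e1', e2'⟩ <;>
      omega
  have hv : ∀ x y, (sw1 N α β x y ≤ sw1 N α β x (y + 1) ∧ sw1 N α β x (y + 1) ≤ sw1 N α β x y + 1) ∧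
      (sw2 N α β x y ≤ sw2 N α β x (y + 1) ∧ sw2 N α β x (y + 1) ≤ sw2 N α β x y + 1) := by
    intro x y
    have a1 := hα.mono x y
    have a2 := hβ.mono x y
    have a3 := hα.step x y
    have a4 := hβ.step x y
    by_cases h : α x y ≠ β x y ∧ α x (y + 1) ≠ β x (y + 1)
    · have := FF_vert (N := N) h.1 h.2
      rcases sw_cases N α β x y with ⟨f, e1, e2⟩ | ⟨f, e1, e2⟩ <;>
      rcases sw_cases N α β x (y + 1) with ⟨f', e1', e2'⟩ | ⟨f', e1', e2'⟩ <;>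
      first | (exfalso; tauto) | omega
    · rcases sw_cases N α β x y with ⟨f, e1, e2⟩ | ⟨f, e1, e2⟩ <;>
      rcases sw_cases N α β x (y + 1) with ⟨f', e1', e2'⟩ | ⟨f', e1', e2'⟩ <;>
      omega
  exact ⟨⟨fun x y => (hh x y).1, fun x y => (hv x y).1.1, fun x y => (hv x y).1.2⟩,
    ⟨fun x y => (hh x y).2, fun x y => (hv x y).2.1, fun x y => (hv x y).2.2⟩⟩

theorem sw_bd (hα : Arr α) (hβ : Arr β) (N x y : ℕ) (hy : y = 0 ∨ N ≤ y) :
    sw1 N α β x y = max (α x y) (β x y) ∧ sw2 N α β x y = min (α x y) (β x y) := by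
  rcases sw_cases N α β x y with ⟨f, e1, e2⟩ | ⟨f, e1, e2⟩
  · have := FF_lt hα hβ f
    omega
  · have : ¬ α x y < β x y := by
      intro h
      exact f ⟨(x, y), ⟨hy, h⟩, Relation.ReflTransGen.refl⟩
    omega

theorem sw_tw (hα : Arr α) (hβ : Arr β) (N x y : ℕ) : tw (sw1 N α β) (sw2 N α β) x y = tw α β x y := by
  have a1 := hα.mono x y
  have a2 := hβ.mono x y
  have a3 := (sw_arr hα hβ N).1.mono x y
  have a4 := (sw_arr hα hβ N).2.mono x y
  unfold tw inc
  rcases sw_cases N α β x y with ⟨f, e1, e2⟩ | ⟨f, e1, e2⟩ <;>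
  rcases sw_cases N α β x (y + 1) with ⟨f', e1', e2'⟩ | ⟨f', e1', e2'⟩ <;>
  omega

theorem sw_yam (hα : Arr α) (hβ : Arr β) (N C : ℕ) (h : Yam N C α β) : Yam N C (sw1 N α β) (sw2 N α β) := by
  intro j hj i hi
  have hR : ∀ j i, Rr C (sw1 N α β) (sw2 N α β) j i = Rr C α β j i := by
    intro j i
    unfold Rr
    exact Finset.sum_congr rfl fun x _ => sw_tw hα hβ N x i
  obtain ⟨h1, h2⟩ := h j hj i hi
  unfold VX at h1
  unfold VY at h2
  unfold VX VY
  rw [hR, hR, sw_tw hα hβ, sw_tw hα hβ]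
  refine ⟨?_, h2⟩
  have hRle : Rr C α β j (i + 1) ≤ Rr C α β j i := by
    by_cases hj' : j + 1 < C
    · have := (h (j + 1) hj' i hi).2
      unfold VY at this
      have e : ∀ i, Rr C α β j i = Rr C α β (j + 1) i + tw α β (j + 1) i := by
        intro i
        unfold Rr
        rw [Finset.sum_eq_sum_Ico_succ_bot hj', add_comm]
      rw [e, e]
      omega
    · unfold Rr
      rw [Finset.Ico_eq_empty (by omega)]
      simp
  intro hv
  have t0 := sw_tw hα hβ N j i
  have t1 := sw_tw hα hβ N j (i + 1)
  have a1 := hα.mono j i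
  have a2 := hβ.mono j i
  have a3 := hα.step j i
  have a4 := hβ.step j i
  have b1 := hα.mono j (i + 1)
  have b2 := hβ.mono j (i + 1)
  have b3 := hα.step j (i + 1)
  have b4 := hβ.step j (i + 1)
  have v0 := FF_vert (N := N) (α := α) (β := β) (x := j) (y := i)
  have v1 := FF_vert (N := N) (α := α) (β := β) (x := j) (y := i + 1)
  have l0 := FF_lt (N := N) hα hβ (x := j) (y := i)
  have l1 := FF_lt (N := N) hα hβ (x := j) (y := i + 1)
  have l2 := FF_lt (N := N) hα hβ (x := j) (y := i + 1 + 1)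
  unfold xw inc at h1 hv
  unfold tw inc at h2 t0 t1
  rcases sw_cases N α β j i with ⟨f, e1, e2⟩ | ⟨f, e1, e2⟩ <;>
  rcases sw_cases N α β j (i + 1) with ⟨f', e1', e2'⟩ | ⟨f', e1', e2'⟩ <;>
  rcases sw_cases N α β j (i + 1 + 1) with ⟨f'', e1'', e2''⟩ | ⟨f'', e1'', e2''⟩ <;>
  simp only [f, f', f'', e1, e2, e1', e2', e1'', e2'', iff_true, true_iff, iff_false, false_iff, not_true_eq_false,
    imp_false, forall_const, false_imp_iff, true_imp_iff] at v0 v1 l0 l1 l2 hv t0 t1 <;>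
  split_ifs at h1 hv <;> omega

end


theorem sw_inj {N : ℕ} {m l r n : ℕ → ℕ} {α β α' β' : ℕ → ℕ → ℕ} (t1 : Tab N m l α) (t2 : Tab N r n β)
    (t1' : Tab N m l α') (t2' : Tab N r n β') (e1 : sw1 N α β = sw1 N α' β') (e2 : sw2 N α β = sw2 N α' β') :
    α = α' ∧ β = β' := by
  have hmn : mnn α β = mnn α' β' := by
    funext x y
    have h1 := congrFun (congrFun e1 x) y
    have h2 := congrFun (congrFun e2 x) y
    unfold mnn
    rcases sw_cases N α β x y with ⟨f, e1, e2⟩ | ⟨f, e1, e2⟩ <;>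
    rcases sw_cases N α' β' x y with ⟨f', e1', e2'⟩ | ⟨f', e1', e2'⟩ <;> omega
  have hmx : mxx α β = mxx α' β' := by
    funext x y
    have h1 := congrFun (congrFun e1 x) y
    have h2 := congrFun (congrFun e2 x) y
    unfold mxx
    rcases sw_cases N α β x y with ⟨f, e1, e2⟩ | ⟨f, e1, e2⟩ <;>
    rcases sw_cases N α' β' x y with ⟨f', e1', e2'⟩ | ⟨f', e1', e2'⟩ <;> omega
  have hF : ∀ p, FF N α β p ↔ FF N α' β' p := by
    intro p
    unfold FF
    rw [hmn, hmx]
    apply exists_congr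
    intro q
    apply and_congr_left
    intro _
    apply and_congr_right
    rintro (h | h)
    · rw [h, t1.bot, t1'.bot, t2.bot, t2'.bot]
    · rw [t1.top _ _ h, t1'.top _ _ h, t2.top _ _ h, t2'.top _ _ h]
  constructor
  all_goals
    funext x y
    have h1 := congrFun (congrFun e1 x) y
    have h2 := congrFun (congrFun e2 x) y
    have h3 := hF (x, y)
    rcases sw_cases N α β x y with ⟨f, e1, e2⟩ | ⟨f, e1, e2⟩ <;>
    rcases sw_cases N α' β' x y with ⟨f', e1', e2'⟩ | ⟨f', e1', e2'⟩ <;>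
    first | (exfalso; tauto) | omega

/-- the additive monoid generated by Schur polynomials -/
noncomputable def SP (N : ℕ) : AddSubmonoid (MvPolynomial (Fin N) ℤ) :=
  AddSubmonoid.closure {f | ∃ (k : ℕ) (lam : ℕ → ℕ), Antitone lam ∧ (∀ j, k ≤ j → lam j = 0) ∧
    f = skewSchur N k lam (fun _ => 0)}

theorem SP_basic {N k : ℕ} {lam : ℕ → ℕ} (h1 : Antitone lam) (h2 : ∀ j, k ≤ j → lam j = 0) :
    skewSchur N k lam (fun _ => 0) ∈ SP N := AddSubmonoid.subset_closure ⟨k, lam, h1, h2, rfl⟩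

theorem SP_nonneg {N : ℕ} {f : MvPolynomial (Fin N) ℤ} (h : f ∈ SP N) : IsSchurNonneg N f := by
  unfold SP at h
  induction h using AddSubmonoid.closure_induction with
  | mem x hx =>
    obtain ⟨k, lam, h1, h2, rfl⟩ := hx
    exact ⟨1, fun _ => 1, fun _ => k, fun _ => lam, fun _ => h1, fun _ => h2, by simp⟩
  | zero => exact ⟨0, fun _ => 0, fun _ => 0, fun _ _ => 0, fun i => i.elim0, fun i => i.elim0, by simp⟩
  | add x y _ _ hx hy =>
    obtain ⟨m, c, k, lam, h1, h2, rfl⟩ := hx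
    obtain ⟨m', c', k', lam', h1', h2', rfl⟩ := hy
    refine ⟨m + m', Fin.append c c', Fin.append k k', Fin.append lam lam', ?_, ?_, ?_⟩
    · intro i
      refine Fin.addCases (fun i => ?_) (fun i => ?_) i
      · rw [Fin.append_left]; exact h1 i
      · rw [Fin.append_right]; exact h1' i
    · intro i
      refine Fin.addCases (fun i => ?_) (fun i => ?_) i
      · rw [Fin.append_left, Fin.append_left]; exact h2 i
      · rw [Fin.append_right, Fin.append_right]; exact h2' i
    · rw [Fin.sum_univ_add]
      simp only [Fin.append_left, Fin.append_right]

/-- partitions with at most `k` parts -/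
structure Pt (k : ℕ) (f : ℕ → ℕ) : Prop where
  anti : Antitone f
  zero : ∀ j, k ≤ j → f j = 0

theorem Pt.isPart {k : ℕ} {f : ℕ → ℕ} (h : Pt k f) : IsPart f := ⟨h.anti, k, h.zero⟩

theorem wtn_zero (N C : ℕ) (o : (ℕ → ℕ → ℕ) × (ℕ → ℕ → ℕ)) (j : ℕ) (hj : N ≤ j) : wtn N C o j = 0 := by
  unfold wtn
  rw [if_neg (by omega)]

theorem skew_mul_SP {N k k' : ℕ} {lam mu nu rho : ℕ → ℕ} (hl : Pt k lam) (hm : Pt k mu)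
    (hn : Pt k' nu) (hr : Pt k' rho) : skewSchur N k lam mu * skewSchur N k' nu rho ∈ SP N := by
  classical
  rw [LR N k k' (lam 0 + nu 0) lam mu nu rho hl.isPart hm.isPart hn.isPart hr.isPart hl.zero hm.zero hn.zero hr.zero
    (fun i => (hl.anti (Nat.zero_le i)).trans (by omega)) (fun i => (hn.anti (Nat.zero_le i)).trans (by omega))]
  apply AddSubmonoid.sum_mem
  intro o ho
  rw [mem_filter] at ho
  exact SP_basic (Yam_anti ho.2) (wtn_zero _ _ _)

theorem skewSchur_k0 (N : ℕ) : skewSchur N 0 (fun _ => 0) (fun _ => 0) = 1 := by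
  unfold skewSchur
  simp

theorem Pt_zero (k : ℕ) : Pt k (fun _ => 0) := ⟨fun _ _ _ => le_rfl, fun _ _ => rfl⟩

theorem SP_mul_skew {N k : ℕ} {lam mu : ℕ → ℕ} (hl : Pt k lam) (hm : Pt k mu) {f : MvPolynomial (Fin N) ℤ}
    (hf : f ∈ SP N) : f * skewSchur N k lam mu ∈ SP N := by
  unfold SP at hf
  induction hf using AddSubmonoid.closure_induction with
  | mem x hx =>
    obtain ⟨k', nu, h1, h2, rfl⟩ := hx
    exact skew_mul_SP ⟨h1, h2⟩ (Pt_zero _) hl hm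
  | zero => rw [zero_mul]; exact zero_mem _
  | add x y _ _ hx hy => rw [add_mul]; exact add_mem hx hy

theorem SP_mul_prod {N k : ℕ} {ι : Type*} (s : Finset ι) (lam mu : ι → ℕ → ℕ) (hl : ∀ i, Pt k (lam i))
    (hm : ∀ i, Pt k (mu i)) {f : MvPolynomial (Fin N) ℤ}
    (hf : f ∈ SP N) : f * ∏ i ∈ s, skewSchur N k (lam i) (mu i) ∈ SP N := by
  classical
  induction s using Finset.induction_on with
  | empty => simpa using hf
  | insert a s ha ih =>
    rw [Finset.prod_insert ha, mul_comm (skewSchur N k (lam a) (mu a)), ← mul_assoc]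
    exact SP_mul_skew (hl a) (hm a) ih

theorem Pt_max {k : ℕ} {f g : ℕ → ℕ} (hf : Pt k f) (hg : Pt k g) : Pt k (fun i => max (f i) (g i)) :=
  ⟨fun _ _ h => max_le_max (hf.anti h) (hg.anti h), fun j hj => by rw [hf.zero j hj, hg.zero j hj]; rfl⟩

theorem Pt_min {k : ℕ} {f g : ℕ → ℕ} (hf : Pt k f) (hg : Pt k g) : Pt k (fun i => min (f i) (g i)) :=
  ⟨fun _ _ h => min_le_min (hf.anti h) (hg.anti h), fun j hj => by rw [hf.zero j hj, hg.zero j hj]; rfl⟩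

theorem conj_max {k : ℕ} {f g : ℕ → ℕ} (hf : Pt k f) (hg : Pt k g) (j : ℕ) :
    conjPart (fun i => max (f i) (g i)) j = max (conjPart f j) (conjPart g j) := by
  apply eq_of_forall_lt_iff
  intro i
  rw [lt_conj (Pt_max hf hg).isPart, lt_max_iff, lt_max_iff, lt_conj hf.isPart, lt_conj hg.isPart]

theorem conj_min {k : ℕ} {f g : ℕ → ℕ} (hf : Pt k f) (hg : Pt k g) (j : ℕ) :
    conjPart (fun i => min (f i) (g i)) j = min (conjPart f j) (conjPart g j) := by
  apply eq_of_forall_lt_iff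
  intro i
  rw [lt_conj (Pt_min hf hg).isPart, lt_min_iff, lt_min_iff, lt_conj hf.isPart, lt_conj hg.isPart]

theorem sw_wtn {α β : ℕ → ℕ → ℕ} (hα : Arr α) (hβ : Arr β) (N C : ℕ) :
    wtn N C (sw1 N α β, sw2 N α β) = wtn N C (α, β) := by
  have h : ∀ (o : (ℕ → ℕ → ℕ) × (ℕ → ℕ → ℕ)) y, wtp C o y = ∑ x ∈ range C, tw o.1 o.2 x y := by
    intro o y
    unfold wtp tinc tw inc
    rw [Finset.sum_add_distrib]
  funext y
  unfold wtn
  rw [h, h]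
  simp only [sw_tw hα hβ]

theorem pair_thm {N k : ℕ} {lam mu nu rho : ℕ → ℕ} (hl : Pt k lam) (hm : Pt k mu)
    (hn : Pt k nu) (hr : Pt k rho) :
    skewSchur N k (fun i => max (lam i) (nu i)) (fun i => max (mu i) (rho i)) *
      skewSchur N k (fun i => min (lam i) (nu i)) (fun i => min (mu i) (rho i)) -
      skewSchur N k lam mu * skewSchur N k nu rho ∈ SP N := by
  classical
  have b1 : ∀ i, lam i ≤ lam 0 + nu 0 := fun i => (hl.anti (Nat.zero_le i)).trans (by omega)
  have b2 : ∀ i, nu i ≤ lam 0 + nu 0 := fun i => (hn.anti (Nat.zero_le i)).trans (by omega)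
  rw [LR N k k (lam 0 + nu 0) lam mu nu rho hl.isPart hm.isPart hn.isPart hr.isPart hl.zero hm.zero hn.zero hr.zero
    b1 b2, LR N k k (lam 0 + nu 0) _ _ _ _ (Pt_max hl hn).isPart (Pt_max hm hr).isPart (Pt_min hl hn).isPart
    (Pt_min hm hr).isPart (Pt_max hl hn).zero (Pt_max hm hr).zero (Pt_min hl hn).zero (Pt_min hm hr).zero
    (fun i => max_le (b1 i) (b2 i)) (fun i => (min_le_left _ _).trans (b1 i))]
  set C := lam 0 + nu 0
  set F1 := (tabF N (conjPart mu) (conjPart lam) (isPart_conj hl.isPart) ×ˢ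
        tabF N (conjPart rho) (conjPart nu) (isPart_conj hn.isPart)).filter (fun o => Yam N C o.1 o.2) with hF1
  set F2 := (tabF N (conjPart fun i => max (mu i) (rho i)) (conjPart fun i => max (lam i) (nu i))
      (isPart_conj (Pt_max hl hn).isPart) ×ˢ
        tabF N (conjPart fun i => min (mu i) (rho i)) (conjPart fun i => min (lam i) (nu i))
      (isPart_conj (Pt_min hl hn).isPart)).filter (fun o => Yam N C o.1 o.2) with hF2
  let φ : (ℕ → ℕ → ℕ) × (ℕ → ℕ → ℕ) → (ℕ → ℕ → ℕ) × (ℕ → ℕ → ℕ) := fun o => (sw1 N o.1 o.2, sw2 N o.1 o.2)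
  have m1 : ∀ o, o ∈ F1 ↔ ((Tab N (conjPart mu) (conjPart lam) o.1 ∧ Tab N (conjPart rho) (conjPart nu) o.2) ∧
      Yam N C o.1 o.2) := by
    intro o
    rw [hF1, mem_filter, mem_product, mem_tabF, mem_tabF]
  have hsub : F1.image φ ⊆ F2 := by
    intro o' ho'
    obtain ⟨o, ho, rfl⟩ := mem_image.1 ho'
    obtain ⟨⟨t1, t2⟩, hY⟩ := (m1 o).1 ho
    rw [hF2, mem_filter, mem_product, mem_tabF, mem_tabF]
    obtain ⟨a1, a2⟩ := sw_arr t1.arr t2.arr N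
    have bd := sw_bd t1.arr t2.arr N
    refine ⟨⟨⟨a1.anti, a1.mono, a1.step, fun x => ?_, fun x y hy => ?_⟩,
        ⟨a2.anti, a2.mono, a2.step, fun x => ?_, fun x y hy => ?_⟩⟩, sw_yam t1.arr t2.arr N C hY⟩
    · refine (bd x 0 (Or.inl rfl)).1.trans ?_
      rw [t1.bot, t2.bot, conj_max hm hr]
    · refine (bd x y (Or.inr hy)).1.trans ?_
      rw [t1.top x y hy, t2.top x y hy, conj_max hl hn]
    · refine (bd x 0 (Or.inl rfl)).2.trans ?_
      rw [t1.bot, t2.bot, conj_min hm hr]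
    · refine (bd x y (Or.inr hy)).2.trans ?_
      rw [t1.top x y hy, t2.top x y hy, conj_min hl hn]
  have hinj : Set.InjOn φ F1 := by
    intro o ho o' ho' heq
    obtain ⟨⟨t1, t2⟩, hY⟩ := (m1 o).1 ho
    obtain ⟨⟨t1', t2'⟩, hY'⟩ := (m1 o').1 ho'
    obtain ⟨e1, e2⟩ := sw_inj t1 t2 t1' t2' (congrArg Prod.fst heq) (congrArg Prod.snd heq)
    exact Prod.ext e1 e2
  have hs : ∑ o ∈ F1, skewSchur N N (wtn N C o) (fun _ => 0) =
      ∑ o ∈ F1.image φ, skewSchur N N (wtn N C o) (fun _ => 0) := by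
    rw [Finset.sum_image hinj]
    apply Finset.sum_congr rfl
    intro o ho
    obtain ⟨⟨t1, t2⟩, hY⟩ := (m1 o).1 ho
    rw [sw_wtn t1.arr t2.arr]
  rw [hs, ← Finset.sum_sdiff hsub, add_sub_cancel_right]
  apply AddSubmonoid.sum_mem
  intro o ho
  have := (mem_filter.1 (mem_sdiff.1 ho).1).2
  exact SP_basic (Yam_anti this) (wtn_zero _ _ _)


theorem skewSchur_shift (N k a : ℕ) (f g f' g' : ℕ → ℕ) (hf : ∀ i < k, f' i = f i + a) (hg : ∀ i < k, g' i = g i + a) :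
    skewSchur N k f' g' = skewSchur N k f g := by
  unfold skewSchur
  congr 1
  ext1 i j
  simp only [Matrix.of_apply]
  rw [hf i i.2, hg j j.2]
  congr 1
  push_cast
  ring

def up1 (k : ℕ) (f : ℕ → ℕ) (j : ℕ) : ℕ := if j < k then f j + 1 else 0

theorem up1_Pt {k : ℕ} {f : ℕ → ℕ} (hf : Pt k f) : Pt k (up1 k f) := by
  constructor
  · intro i j hij
    have := hf.anti hij
    unfold up1
    split_ifs <;> omega
  · intro j hj
    unfold up1
    rw [if_neg (by omega)]

def mva (f g : ℕ → ℕ) (j : ℕ) : ℕ := max (f j - 1) (g j)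
def mvb (f g : ℕ → ℕ) (j : ℕ) : ℕ := min (f j) (g j + 1)

theorem mva_Pt {k : ℕ} {f g : ℕ → ℕ} (hf : Pt k f) (hg : Pt k g) : Pt k (mva f g) := by
  constructor
  · intro i j hij
    have := hf.anti hij
    have := hg.anti hij
    unfold mva
    omega
  · intro j hj
    unfold mva
    rw [hf.zero j hj, hg.zero j hj]
    rfl

theorem mvb_Pt {k : ℕ} {f g : ℕ → ℕ} (hf : Pt k f) (hg : Pt k g) : Pt k (mvb f g) := by
  constructor
  · intro i j hij
    have := hf.anti hij
    have := hg.anti hij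
    unfold mvb
    omega
  · intro j hj
    unfold mvb
    rw [hf.zero j hj, hg.zero j hj]
    rfl

theorem pair_one {N k : ℕ} {lam mu nu rho : ℕ → ℕ} (hl : Pt k lam) (hm : Pt k mu)
    (hn : Pt k nu) (hr : Pt k rho) :
    skewSchur N k (mva lam nu) (mva mu rho) * skewSchur N k (mvb lam nu) (mvb mu rho) -
      skewSchur N k lam mu * skewSchur N k nu rho ∈ SP N := by
  have h := pair_thm (N := N) hl hm (up1_Pt hn) (up1_Pt hr)
  rw [skewSchur_shift N k 1 nu rho (up1 k nu) (up1 k rho) (fun i hi => if_pos hi) (fun i hi => if_pos hi),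
    skewSchur_shift N k 1 (mva lam nu) (mva mu rho) (fun i => max (lam i) (up1 k nu i))
      (fun i => max (mu i) (up1 k rho i))
      (fun i hi => by unfold up1 mva; rw [if_pos hi]; omega)
      (fun i hi => by unfold up1 mva; rw [if_pos hi]; omega),
    skewSchur_shift N k 0 (mvb lam nu) (mvb mu rho) (fun i => min (lam i) (up1 k nu i))
      (fun i => min (mu i) (up1 k rho i))
      (fun i hi => by unfold up1 mvb; rw [if_pos hi]; omega)
      (fun i hi => by unfold up1 mvb; rw [if_pos hi]; omega)] at h
  exact h

def c1 (f g : ℕ → ℕ) (j : ℕ) : ℕ := max (mva f g j) (mvb f g j)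
def c2 (f g : ℕ → ℕ) (j : ℕ) : ℕ := min (mva f g j) (mvb f g j)

theorem c1_Pt {k : ℕ} {f g : ℕ → ℕ} (hf : Pt k f) (hg : Pt k g) : Pt k (c1 f g) :=
  Pt_max (mva_Pt hf hg) (mvb_Pt hf hg)
theorem c2_Pt {k : ℕ} {f g : ℕ → ℕ} (hf : Pt k f) (hg : Pt k g) : Pt k (c2 f g) :=
  Pt_min (mva_Pt hf hg) (mvb_Pt hf hg)

theorem pair_two {N k : ℕ} {lam mu nu rho : ℕ → ℕ} (hl : Pt k lam) (hm : Pt k mu)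
    (hn : Pt k nu) (hr : Pt k rho) :
    skewSchur N k (c1 lam nu) (c1 mu rho) * skewSchur N k (c2 lam nu) (c2 mu rho) -
      skewSchur N k lam mu * skewSchur N k nu rho ∈ SP N := by
  have h1 := pair_one (N := N) hl hm hn hr
  have h2 := pair_thm (N := N) (mva_Pt hl hn) (mva_Pt hm hr) (mvb_Pt hl hn) (mvb_Pt hm hr)
  have := add_mem h2 h1
  rw [sub_add_sub_cancel] at this
  exact this

theorem c_cases (f g : ℕ → ℕ) (j : ℕ) :
    (f j < g j ∧ c1 f g j = g j ∧ c2 f g j = f j) ∨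
    (g j ≤ f j ∧ f j ≤ g j + 1 ∧ c1 f g j = f j ∧ c2 f g j = g j) ∨
    (g j + 2 ≤ f j ∧ c1 f g j + 1 = f j ∧ c2 f g j = g j + 1) := by
  unfold c1 c2 mva mvb
  omega

theorem meas_le (n t t' : ℕ) (h1 : t < t') (h2 : t' < n) (f g : ℕ → ℕ) (j : ℕ) :
    (n * c1 f g j + t) ^ 2 + (n * c2 f g j + t') ^ 2 ≤ (n * f j + t) ^ 2 + (n * g j + t') ^ 2 ∧
    (¬ (g j ≤ f j ∧ f j ≤ g j + 1) →
    (n * c1 f g j + t) ^ 2 + (n * c2 f g j + t') ^ 2 < (n * f j + t) ^ 2 + (n * g j + t') ^ 2) := by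
  rcases c_cases f g j with ⟨h, e1, e2⟩ | ⟨h, h', e1, e2⟩ | ⟨h, e1, e2⟩
  · rw [e1, e2]
    have : (n * g j + t) ^ 2 + (n * f j + t') ^ 2 < (n * f j + t) ^ 2 + (n * g j + t') ^ 2 := by
      obtain ⟨d, hd⟩ := Nat.exists_eq_add_of_lt h
      obtain ⟨e, he⟩ := Nat.exists_eq_add_of_lt h1
      rw [hd, he]
      have : 0 < n := by omega
      have h3 : 0 < n * (d + 1) * (e + 1) := by positivity
      nlinarith
    exact ⟨this.le, fun _ => this⟩
  · rw [e1, e2]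
    exact ⟨le_rfl, fun hc => absurd ⟨h, h'⟩ hc⟩
  · rw [e2]
    have : (n * c1 f g j + t) ^ 2 + (n * (g j + 1) + t') ^ 2 < (n * f j + t) ^ 2 + (n * g j + t') ^ 2 := by
      rw [← e1]
      have h4 : g j + 1 ≤ c1 f g j := by omega
      obtain ⟨d, hd⟩ := Nat.exists_eq_add_of_le h4
      rw [hd]
      obtain ⟨e, he⟩ := Nat.exists_eq_add_of_lt h2
      have : 0 < n := by omega
      have h5 : n * t' < n * (t + n) := Nat.mul_lt_mul_of_pos_left (by omega) this
      have h6 : 0 ≤ n * n * d := by positivity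
      nlinarith
    exact ⟨this.le, fun _ => this⟩

section
variable {n : ℕ} {X : Type*}

def upd (P : Fin n → X) (t t' : Fin n) (a b : X) : Fin n → X := Function.update (Function.update P t a) t' b

theorem upd_self (P : Fin n → X) (t t' : Fin n) : upd P t t' (P t) (P t') = P := by
  unfold upd
  rw [Function.update_eq_self, Function.update_eq_self]

theorem upd_prop (P : Fin n → X) (t t' : Fin n) (a b : X) (Q : X → Prop) (hP : ∀ i, Q (P i)) (ha : Q a) (hb : Q b)
    (i : Fin n) : Q (upd P t t' a b i) := by
  unfold upd
  rw [Function.update_apply, Function.update_apply]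
  split_ifs
  · exact hb
  · exact ha
  · exact hP i

theorem sum_upd (F : Fin n → X → ℕ) (P : Fin n → X) (t t' : Fin n) (h : t ≠ t') (a b : X) :
    ∑ i, F i (upd P t t' a b i) = F t a + F t' b + ∑ i ∈ (univ.erase t).erase t', F i (P i) := by
  rw [← Finset.add_sum_erase _ _ (mem_univ t), ← Finset.add_sum_erase (univ.erase t) _
    (mem_erase.2 ⟨h.symm, mem_univ t'⟩), ← add_assoc]
  congr 1
  · unfold upd
    simp [h]
  · apply Finset.sum_congr rfl
    intro i hi
    rw [mem_erase, mem_erase] at hi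
    unfold upd
    rw [Function.update_of_ne hi.1, Function.update_of_ne hi.2.1]

theorem prod_upd {R : Type*} [CommRing R] (F : X → R) (P : Fin n → X) (t t' : Fin n) (h : t ≠ t') (a b : X) :
    ∏ i, F (upd P t t' a b i) = F a * F b * ∏ i ∈ (univ.erase t).erase t', F (P i) := by
  rw [← Finset.mul_prod_erase _ _ (mem_univ t), ← Finset.mul_prod_erase (univ.erase t) _
    (mem_erase.2 ⟨h.symm, mem_univ t'⟩), ← mul_assoc]
  congr 1
  · unfold upd
    simp [h]
  · apply Finset.prod_congr rfl
    intro i hi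
    rw [mem_erase, mem_erase] at hi
    unfold upd
    rw [Function.update_of_ne hi.1, Function.update_of_ne hi.2.1]

end

theorem brace_eq (n k : ℕ) (L : Fin n → ℕ → ℕ) (hL : ∀ t, Pt k (L t))
    (hterm : ∀ t t' : Fin n, t < t' → ∀ j, L t' j ≤ L t j ∧ L t j ≤ L t' j + 1) (t : Fin n) :
    braceQuot n t (fun j => ∑ s : Fin n, L s j) = L t := by
  have hn : 0 < n := t.pos
  have hS : Pt k (fun j => ∑ s : Fin n, L s j) :=
    ⟨fun i j hij => Finset.sum_le_sum fun s _ => (hL s).anti hij,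
      fun j hj => Finset.sum_eq_zero fun s _ => (hL s).zero j hj⟩
  have hc := isPart_conj hS.isPart
  have hP : IsPart (fun j => conjPart (fun j => ∑ s : Fin n, L s j) (t + j * n)) := by
    refine ⟨fun i j hij => hc.anti (Nat.add_le_add_left (Nat.mul_le_mul_right n hij) t), ?_⟩
    obtain ⟨K, hK⟩ := hc.fin
    refine ⟨K, fun i hi => hK _ ?_⟩
    have : i * 1 ≤ i * n := Nat.mul_le_mul_left i hn
    omega
  funext j
  apply eq_of_forall_lt_iff
  intro i
  unfold braceQuot
  rw [lt_conj hP, lt_conj hS.isPart]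
  constructor
  · intro h
    by_contra hc
    have hb : ∀ s ∈ (univ : Finset (Fin n)), L s j ≤ i + if s < t then 1 else 0 := by
      intro s _
      rcases lt_trichotomy s t with h1 | h1 | h1
      · rw [if_pos h1]
        have := (hterm s t h1 j).2
        omega
      · subst h1; omega
      · have := (hterm t s h1 j).1
        omega
    have h2 := Finset.sum_le_sum hb
    rw [Finset.sum_add_distrib, Finset.sum_boole, Finset.filter_gt_eq_Iio] at h2
    simp at h2
    rw [mul_comm] at h
    omega
  · intro h
    have hb : ∀ s ∈ (univ : Finset (Fin n)), (i + if s ≤ t then 1 else 0) ≤ L s j := by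
      intro s _
      rcases lt_trichotomy s t with h1 | h1 | h1
      · rw [if_pos h1.le]
        have := (hterm s t h1 j).1
        omega
      · subst h1; simp; omega
      · have := (hterm t s h1 j).2
        rw [if_neg (not_le.2 h1)]
        omega
    have h2 := Finset.sum_le_sum hb
    rw [Finset.sum_add_distrib, Finset.sum_boole, Finset.filter_ge_eq_Iic] at h2
    simp at h2
    rw [mul_comm]
    omega

/-- measure -/
def mea (n k : ℕ) (P : Fin n → (ℕ → ℕ) × (ℕ → ℕ)) : ℕ :=
  ∑ t : Fin n, ∑ j ∈ range k, ((n * (P t).1 j + t) ^ 2 + (n * (P t).2 j + t) ^ 2)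

theorem main_aux (N n k : ℕ) (lam mu : ℕ → ℕ) : ∀ (w : ℕ) (P : Fin n → (ℕ → ℕ) × (ℕ → ℕ)), mea n k P = w →
    (∀ t, Pt k (P t).1 ∧ Pt k (P t).2) → (∀ j, ∑ t, (P t).1 j = lam j) → (∀ j, ∑ t, (P t).2 j = mu j) →
    ∏ i : Fin n, skewSchur N k (braceQuot n i lam) (braceQuot n i mu) - ∏ i : Fin n, skewSchur N k (P i).1 (P i).2
      ∈ SP N := by
  intro w
  induction w using Nat.strong_induction_on with
  | _ w ih =>
  intro P hw hP hl hm
  by_cases hterm : ∀ t t' : Fin n, t < t' → ∀ j, ((P t').1 j ≤ (P t).1 j ∧ (P t).1 j ≤ (P t').1 j + 1) ∧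
      ((P t').2 j ≤ (P t).2 j ∧ (P t).2 j ≤ (P t').2 j + 1)
  · have e1 : lam = fun j => ∑ t, (P t).1 j := funext fun j => (hl j).symm
    have e2 : mu = fun j => ∑ t, (P t).2 j := funext fun j => (hm j).symm
    have b1 := brace_eq n k (fun t => (P t).1) (fun t => (hP t).1) (fun t t' h j => (hterm t t' h j).1)
    have b2 := brace_eq n k (fun t => (P t).2) (fun t => (hP t).2) (fun t t' h j => (hterm t t' h j).2)
    rw [e1, e2]
    simp only [b1, b2, sub_self]
    exact zero_mem _
  · push Not at hterm
    obtain ⟨t, t', htt, j, hj⟩ := hterm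
    set a := (c1 (P t).1 (P t').1, c1 (P t).2 (P t').2) with ha
    set b := (c2 (P t).1 (P t').1, c2 (P t).2 (P t').2) with hb
    have hne : t ≠ t' := htt.ne
    have hPt : ∀ i, Pt k (upd P t t' a b i).1 ∧ Pt k (upd P t t' a b i).2 :=
      upd_prop P t t' a b (fun x => Pt k x.1 ∧ Pt k x.2) hP
        ⟨c1_Pt (hP t).1 (hP t').1, c1_Pt (hP t).2 (hP t').2⟩ ⟨c2_Pt (hP t).1 (hP t').1, c2_Pt (hP t).2 (hP t').2⟩
    have hjk : j < k := by
      by_contra hc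
      rw [(hP t).1.zero j (by omega), (hP t').1.zero j (by omega), (hP t).2.zero j (by omega),
        (hP t').2.zero j (by omega)] at hj
      simp at hj
    have hsum : ∀ (f g : ℕ → ℕ) j, c1 f g j + c2 f g j = f j + g j := by
      intro f g j
      have := c_cases f g j
      omega
    have hmea : mea n k (upd P t t' a b) < w := by
      rw [← hw]
      have m1 := sum_upd (fun t (x : (ℕ → ℕ) × (ℕ → ℕ)) => ∑ j ∈ range k, ((n * x.1 j + t) ^ 2 + (n * x.2 j + t) ^ 2))
        P t t' hne a b
      have m2 := sum_upd (fun t (x : (ℕ → ℕ) × (ℕ → ℕ)) => ∑ j ∈ range k, ((n * x.1 j + t) ^ 2 + (n * x.2 j + t) ^ 2))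
        P t t' hne (P t) (P t')
      rw [upd_self] at m2
      unfold mea
      rw [m1, m2]
      apply Nat.add_lt_add_right
      rw [← Finset.sum_add_distrib, ← Finset.sum_add_distrib]
      have q1 := meas_le n t t' htt t'.2 (P t).1 (P t').1
      have q2 := meas_le n t t' htt t'.2 (P t).2 (P t').2
      apply Finset.sum_lt_sum
      · intro i _
        have := (q1 i).1
        have := (q2 i).1
        simp only [ha, hb]
        omega
      · refine ⟨j, mem_range.2 hjk, ?_⟩
        have r1 := (q1 j).1
        have r2 := (q2 j).1
        have r3 := (q1 j).2
        have r4 := (q2 j).2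
        simp only [ha, hb]
        by_cases h : (P t').1 j ≤ (P t).1 j ∧ (P t).1 j ≤ (P t').1 j + 1
        · have := r4 (fun h' => absurd (hj h h'.1) (not_lt.2 h'.2))
          omega
        · have := r3 h
          omega
    have key := ih _ hmea (upd P t t' a b) rfl hPt
      (by
        intro j
        have m1 := sum_upd (fun t (x : (ℕ → ℕ) × (ℕ → ℕ)) => x.1 j) P t t' hne a b
        have m2 := sum_upd (fun t (x : (ℕ → ℕ) × (ℕ → ℕ)) => x.1 j) P t t' hne (P t) (P t')
        rw [upd_self] at m2
        have := hsum (P t).1 (P t').1 j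
        rw [← hl j, m1, m2]
        simp only [ha, hb]
        omega)
      (by
        intro j
        have m1 := sum_upd (fun t (x : (ℕ → ℕ) × (ℕ → ℕ)) => x.2 j) P t t' hne a b
        have m2 := sum_upd (fun t (x : (ℕ → ℕ) × (ℕ → ℕ)) => x.2 j) P t t' hne (P t) (P t')
        rw [upd_self] at m2
        have := hsum (P t).2 (P t').2 j
        rw [← hm j, m1, m2]
        simp only [ha, hb]
        omega)
    have p1 := prod_upd (fun (x : (ℕ → ℕ) × (ℕ → ℕ)) => skewSchur N k x.1 x.2) P t t' hne a b
    have p2 := prod_upd (fun (x : (ℕ → ℕ) × (ℕ → ℕ)) => skewSchur N k x.1 x.2) P t t' hne (P t) (P t')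
    rw [upd_self] at p2
    have step := SP_mul_prod ((univ.erase t).erase t') (fun i => (P i).1) (fun i => (P i).2) (fun i => (hP i).1)
      (fun i => (hP i).2) (pair_two (N := N) (hP t).1 (hP t).2 (hP t').1 (hP t').2)
    rw [sub_mul] at step
    have tot := add_mem key step
    rw [p1] at tot
    rw [p2]
    simp only [ha, hb] at tot
    rw [sub_add_sub_cancel] at tot
    exact tot

theorem final_thm (n k : ℕ) (lam mu : Fin n → ℕ → ℕ)
    (hlam : ∀ i, Antitone (lam i)) (hmu : ∀ i, Antitone (mu i))
    (hlamk : ∀ i, ∀ j, k ≤ j → lam i j = 0) (hmuk : ∀ i, ∀ j, k ≤ j → mu i j = 0) (N : ℕ) :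
    IsSchurNonneg N
      (∏ i : Fin n,
          skewSchur N k (braceQuot n i (fun j => ∑ t : Fin n, lam t j))
            (braceQuot n i (fun j => ∑ t : Fin n, mu t j))
        - ∏ i : Fin n, skewSchur N k (lam i) (mu i)) :=
  SP_nonneg (main_aux N n k _ _ _ (fun t => (lam t, mu t)) rfl
    (fun t => ⟨⟨hlam t, hlamk t⟩, ⟨hmu t, hmuk t⟩⟩) (fun _ => rfl) (fun _ => rfl))


end

/-- Let `λ⁽¹⁾/μ⁽¹⁾, …, λ⁽ⁿ⁾/μ⁽ⁿ⁾` be `n` skew shapes (each with at most `k`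
parts), and let `Λ = λ⁽¹⁾ + ⋯ + λ⁽ⁿ⁾`, `M = μ⁽¹⁾ + ⋯ + μ⁽ⁿ⁾` (coordinatewise).
Then `∏_{i=1}^n s_{Λ^{{i,n}}/M^{{i,n}}} ≥_s ∏_{i=1}^n s_{λ⁽ⁱ⁾/μ⁽ⁱ⁾}`. -/
theorem schur_nonneg_sum_brace_quotients (n k : ℕ) (lam mu : Fin n → ℕ → ℕ)
    (hlam : ∀ i, Antitone (lam i)) (hmu : ∀ i, Antitone (mu i))
    (hlamk : ∀ i, ∀ j, k ≤ j → lam i j = 0) (hmuk : ∀ i, ∀ j, k ≤ j → mu i j = 0)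
    (hml : ∀ i, ∀ j, mu i j ≤ lam i j)
    (N : ℕ) :
    IsSchurNonneg N
      (∏ i : Fin n,
          skewSchur N k (braceQuot n i (fun j => ∑ t : Fin n, lam t j))
            (braceQuot n i (fun j => ∑ t : Fin n, mu t j))
        - ∏ i : Fin n, skewSchur N k (lam i) (mu i)) := by
  exact final_thm n k lam mu hlam hmu hlamk hmuk N
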